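/- For all integers k ≥ 0, r ≥ 4, a ∈ {1,…,r−3} and b ∈ {1,…,r−2}, the following identity of formal power series in q holds: χ^{(r−1,(k+1)r−k)}_{b,(k+1)a}(q) = f_{a,b} · q^{−k(a−b)²/4} Σ_{n ∈ (ℤ_{≥0})^k} Σ_{m ≡ Q_{a,b}} ( q^{(n + (m_1/2) ε_k)ᵀ B (n + (m_1/2) ε_k)} / ((q)_{n_1} ⋯ (q)_{n_k}) ) · ( q^{(1/4) mᵀC m − (1/2) m_{r−a−1}} / (q)_{m_1} ) ∏_{j=2}^{r−3} [ (1/2)(I m + e_{r−a−1} + e_{r−b−1})_j ; m_j ] (all exponents occurring are integers). -/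

import Mathlib

attribute [local instance] Classical.propDecidable

noncomputable section

variable {K : Type*} [Field K]

/-- `(q)_n` where `q = t^4` (the variable `t` stands for `q^{1/4}`). -/
def qp (t : K) (n : ℕ) : K :=
  ∏ k ∈ Finset.range n, (1 - t ^ (4 * (k + 1)))

/-- Gaussian polynomial `[N; m]` in the variable `q = t^4`. -/
def gauss (t : K) (N m : ℤ) : K :=
  if 0 ≤ m ∧ m ≤ N then qp t N.toNat / (qp t m.toNat * qp t (N - m).toNat) else 0

/-- Gaussian polynomial `[N2/2; m]` (zero if `N2` is odd). -/
def gaussHalf (t : K) (N2 m : ℤ) : K :=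
  if N2 % 2 = 0 then gauss t (N2 / 2) m else 0

/-- Incidence matrix of the Dynkin diagram `A_d` (indices `i : Fin d` stand for `i+1`). -/
def inc (d : ℕ) (i k : Fin d) : ℤ := if (i : ℕ) + 1 = (k : ℕ) ∨ (k : ℕ) + 1 = (i : ℕ) then 1 else 0

/-- Cartan matrix of `A_d`. -/
def cartan (d : ℕ) (i k : Fin d) : ℤ := (if i = k then 2 else 0) - inc d i k

/-- the `s`-th unit vector, with the convention `e_0 = e_{d+1} = 0`. -/
def uv (d : ℕ) (s : ℤ) (i : Fin d) : ℤ := if ((i : ℕ) : ℤ) + 1 = s then 1 else 0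

/-- `m_s`, with the conventions `m_0 = m_{d+1} = 0`. -/
def mAt (d : ℕ) (m : Fin d → ℕ) (s : ℤ) : ℤ := ∑ i, uv d s i * (m i : ℤ)

/-- `mᵀ C m` for the `A_d` Cartan matrix. -/
def quadC (d : ℕ) (m : Fin d → ℕ) : ℤ := ∑ i, ∑ k, (m i : ℤ) * cartan d i k * (m k : ℤ)

/-- the vector `Q_{a,b}`. -/
def Qab (r a b : ℕ) (i : Fin (r - 3)) : ℕ :=
  min (a - 1) (r - ((i : ℕ) + 1) - 2) + min (b - 1) (r - ((i : ℕ) + 1) - 2)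

/-- the parity restriction `m ≡ Q_{a,b} (mod 2)`. -/
def parity (r a b : ℕ) (m : Fin (r - 3) → ℕ) : Prop := ∀ i, m i % 2 = Qab r a b i % 2

/-- `(I m + L e_1 + e_{r-a-1} + e_{r-b-1})_i`. -/
def topE (r a b L : ℕ) (m : Fin (r - 3) → ℕ) (i : Fin (r - 3)) : ℤ :=
  (∑ k, inc (r - 3) i k * (m k : ℤ)) + (L : ℤ) * uv (r - 3) 1 i
    + uv (r - 3) ((r : ℤ) - a - 1) i + uv (r - 3) ((r : ℤ) - b - 1) i

/-- the summand `q^{(1/4) mᵀCm - (1/2) m_{r-a-1}} ∏_j [(1/2)(Im + Le_1 + e_{r-a-1} + e_{r-b-1})_j; m_j]`,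
in the variable `t = q^{1/4}`. -/
def fermTerm (r a b L : ℕ) (t : K) (m : Fin (r - 3) → ℕ) : K :=
  t ^ (quadC (r - 3) m - 2 * mAt (r - 3) m ((r : ℤ) - a - 1))
    * ∏ i, gaussHalf t (topE r a b L m i) (m i)

/-- the fermionic sum `Σ_{m ≡ Q_{a,b}} (⋯)`. -/
def fermSum (r a b L : ℕ) (t : K) : K :=
  ∑ᶠ m : Fin (r - 3) → ℕ, if parity r a b m then fermTerm r a b L t m else 0

/-- `(I m + c e_1 + e_{r-a-1} + e_{r-b-1})_i`. -/
def topC (r a b : ℕ) (c : ℤ) (m : Fin (r - 3) → ℕ) (i : Fin (r - 3)) : ℤ :=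
  (∑ k, inc (r - 3) i k * (m k : ℤ)) + c * uv (r - 3) 1 i
    + uv (r - 3) ((r : ℤ) - a - 1) i + uv (r - 3) ((r : ℤ) - b - 1) i

/-- `m_s` as a natural number (zero if `s` is out of range). -/
def mAtN (d : ℕ) (m : Fin d → ℕ) (s : ℕ) : ℕ :=
  ∑ i : Fin d, if (i : ℕ) + 1 = s then m i else 0

/-- the bilinear form `vᵀ B w` with `B_{j,ℓ} = min(j,ℓ)` (tadpole inverse Cartan matrix). -/
def tadB (k : ℕ) (v w : Fin k → ℤ) : ℤ :=
  ∑ i : Fin k, ∑ l : Fin k, v i * (min ((i : ℕ) + 1) ((l : ℕ) + 1) : ℤ) * w l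

/-- the variable `t = q^{1/4}` in the field of formal Laurent series `ℚ⸨X⸩`. -/
def tL : LaurentSeries ℚ := HahnSeries.single 1 1

/-- the Euler product `(q)_∞ = ∏_{k ≥ 1} (1 - q^k)` with `q = t^4`. -/
def eulerInf : LaurentSeries ℚ := ∏' k : ℕ, (1 - tL ^ (4 * (k + 1)))

/-- the normalized Virasoro character `χ^{(p,p')}_{R,S}(q)`, written in the variable
`t = q^{1/4}` (all exponents multiplied by `4`). -/
def virChar (p p' R S : ℕ) : LaurentSeries ℚ :=
  eulerInf⁻¹ * ∑' j : ℤ,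
    (tL ^ (4 * (j * ((p : ℤ) * p' * j + (p' : ℤ) * R - (p : ℤ) * S)))
      - tL ^ (4 * ((j * p + R) * (j * p' + S))))

/-! ### Part 1: Gaussian polynomials and the Burge transform -/

/-- `hh x u = [x+u; x]`. -/
def hh (t : K) (x u : ℤ) : K := gauss t (x + u) x

lemma hh_eq (t : K) (x u : ℤ) : hh t x u =
    if 0 ≤ x ∧ 0 ≤ u then qp t (x + u).toNat / (qp t x.toNat * qp t u.toNat) else 0 := by
  unfold hh gauss
  have : (0 ≤ x ∧ x ≤ x + u) ↔ (0 ≤ x ∧ 0 ≤ u) := by constructor <;> intro h <;> omega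
  simp only [this, add_sub_cancel_left]

lemma hh_neg_left (t : K) {x u : ℤ} (h : x < 0) : hh t x u = 0 := by
  rw [hh_eq, if_neg (by omega)]

lemma hh_neg_right (t : K) {x u : ℤ} (h : u < 0) : hh t x u = 0 := by
  rw [hh_eq, if_neg (by omega)]

lemma hh_ne (t : K) {x u : ℤ} (h : hh t x u ≠ 0) : 0 ≤ x ∧ 0 ≤ u := by
  by_contra hc
  rw [hh_eq, if_neg hc] at h
  exact h rfl

lemma hh_nat (t : K) (x u : ℕ) : hh t x u = qp t (x + u) / (qp t x * qp t u) := by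
  rw [hh_eq, if_pos (by omega)]
  norm_cast

lemma hh_comm (t : K) (x u : ℤ) : hh t x u = hh t u x := by
  rw [hh_eq, hh_eq, add_comm, mul_comm]
  simp only [and_comm]

lemma qp_zero (t : K) : qp t 0 = 1 := by simp [qp]

lemma qp_succ (t : K) (n : ℕ) : qp t (n + 1) = qp t n * (1 - t ^ (4 * (n + 1))) := by
  simp [qp, Finset.prod_range_succ]

/-- `t` is nonzero and not a relevant root of unity. -/
def Good (t : K) : Prop := t ≠ 0 ∧ ∀ n, qp t n ≠ 0

section
variable {t : K}

lemma hh_zero_left (H : Good t) {u : ℤ} (h : 0 ≤ u) : hh t 0 u = 1 := by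
  lift u to ℕ using h
  rw [show (0:ℤ) = ((0:ℕ):ℤ) from rfl, hh_nat, qp_zero, zero_add, one_mul, div_self (H.2 _)]

lemma hh_zero_right (H : Good t) {u : ℤ} (h : 0 ≤ u) : hh t u 0 = 1 := by
  rw [hh_comm, hh_zero_left H h]

lemma one_sub_ne (H : Good t) (n : ℕ) : (1 : K) - t ^ (4 * (n + 1)) ≠ 0 := by
  have := H.2 (n + 1)
  rw [qp_succ] at this
  exact right_ne_zero_of_mul this

/-- Pascal rule, valid except at `(0,0)`. -/
lemma hh_pascal (H : Good t) {x u : ℤ} (h : ¬ (x = 0 ∧ u = 0)) :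
    hh t x u = hh t (x - 1) u + t ^ (4 * x) * hh t x (u - 1) := by
  by_cases hx : x < 0
  · rw [hh_neg_left t hx, hh_neg_left t (by omega), hh_neg_left t hx]; simp
  by_cases hu : u < 0
  · rw [hh_neg_right t hu, hh_neg_right t hu, hh_neg_right t (by omega)]; simp
  by_cases hx0 : x = 0
  · subst hx0
    rw [hh_zero_left H (by omega), hh_zero_left H (by omega), hh_neg_left t (by omega)]; simp
  by_cases hu0 : u = 0
  · subst hu0
    rw [hh_zero_right H (by omega), hh_zero_right H (by omega), hh_neg_right t (by omega)]; simp
  obtain ⟨x, rfl⟩ : ∃ n : ℕ, x = n + 1 := ⟨(x - 1).toNat, by omega⟩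
  obtain ⟨u, rfl⟩ : ∃ n : ℕ, u = n + 1 := ⟨(u - 1).toNat, by omega⟩
  rw [add_sub_cancel_right, add_sub_cancel_right]
  have e1 := hh_nat t (x + 1) (u + 1)
  have e2 := hh_nat t x (u + 1)
  have e3 := hh_nat t (x + 1) u
  push_cast at e1 e2 e3
  rw [e1, e2, e3]
  have e4 : (t : K) ^ (4 * ((x : ℤ) + 1)) = t ^ (4 * (x + 1)) := by
    rw [← zpow_natCast]; push_cast; rfl
  rw [e4, show x + 1 + (u + 1) = (x + u + 1) + 1 by ring, show x + (u + 1) = x + u + 1 by ring,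
    show x + 1 + u = x + u + 1 by ring, qp_succ t (x + u + 1), qp_succ t x, qp_succ t u]
  have a1 := H.2 x
  have a2 := H.2 u
  have a3 := one_sub_ne H x
  have a4 := one_sub_ne H u
  field_simp
  ring

lemma hh_pascal' (H : Good t) {x u : ℤ} (h : ¬ (x = 0 ∧ u = 0)) :
    hh t x u = t ^ (4 * u) * hh t (x - 1) u + hh t x (u - 1) := by
  rw [hh_comm, hh_pascal H (by omega), hh_comm t (u - 1), hh_comm t u (x - 1), add_comm]

/-- trinomial revision -/
lemma hh_tri (H : Good t) {C w n : ℤ} (hC : 0 ≤ C) :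
    hh t C w * hh t (C - n) n = hh t n w * hh t (C - n) (w + n) := by
  by_cases hw : w < 0
  · rw [hh_neg_right t hw, hh_neg_right t hw]; simp
  by_cases hn : n < 0
  · rw [hh_neg_right t (u := n) hn, hh_neg_left t hn]; simp
  by_cases hcn : C - n < 0
  · rw [hh_neg_left t hcn, hh_neg_left t hcn]; simp
  obtain ⟨m, hm⟩ : ∃ m : ℕ, C - n = m := ⟨(C - n).toNat, by omega⟩
  lift n to ℕ using by omega
  lift w to ℕ using by omega
  obtain rfl : C = ((m + n : ℕ) : ℤ) := by push_cast; omega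
  rw [hm, ← Nat.cast_add, hh_nat, hh_nat, hh_nat, hh_nat]
  have := H.2 m
  have := H.2 n
  have := H.2 w
  have := H.2 (m + n)
  have := H.2 (w + n)
  rw [show m + n + w = m + (w + n) by ring, show n + w = w + n by ring]
  field_simp
end

/-- finitely supported sums over `ℤ` with a given value -/
def HS (f : ℤ → K) (s : K) : Prop := (Function.support f).Finite ∧ ∑ᶠ k, f k = s

lemma HS.mk {f : ℤ → K} (lo hi : ℤ) (h : ∀ k, f k ≠ 0 → lo ≤ k ∧ k ≤ hi) :
    HS f (∑ᶠ k, f k) :=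
  ⟨(Set.finite_Icc lo hi).subset fun k hk => h k hk, rfl⟩

lemma HS.add {f g : ℤ → K} {a b : K} (hf : HS f a) (hg : HS g b) :
    HS (fun k => f k + g k) (a + b) :=
  ⟨(hf.1.union hg.1).subset (Function.support_add f g),
    by rw [finsum_add_distrib hf.1 hg.1, hf.2, hg.2]⟩

lemma HS.sub {f g : ℤ → K} {a b : K} (hf : HS f a) (hg : HS g b) :
    HS (fun k => f k - g k) (a - b) :=
  ⟨(hf.1.union hg.1).subset (Function.support_sub f g),
    by rw [finsum_sub_distrib hf.1 hg.1, hf.2, hg.2]⟩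

lemma HS.mul {f : ℤ → K} {a : K} (c : K) (hf : HS f a) : HS (fun k => c * f k) (c * a) :=
  ⟨hf.1.subset (fun k hk => right_ne_zero_of_mul hk), by rw [← mul_finsum, hf.2]⟩

lemma HS.shift {f : ℤ → K} {a : K} (c : ℤ) (hf : HS f a) : HS (fun k => f (k + c)) a :=
  ⟨hf.1.preimage (Equiv.addRight c).injective.injOn,
    (finsum_comp_equiv (Equiv.addRight c)).trans hf.2⟩

lemma HS.refl {f : ℤ → K} {a : K} (c : ℤ) (hf : HS f a) : HS (fun k => f (c - k)) a :=
  ⟨hf.1.preimage (Equiv.subLeft c).injective.injOn,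
    (finsum_comp_equiv (Equiv.subLeft c)).trans hf.2⟩

lemma HS.congr {f g : ℤ → K} {a : K} (hf : HS f a) (h : ∀ k, g k = f k) : HS g a := by
  rwa [show g = f from funext h]

lemma HS.congr2 {f g : ℤ → K} {a b : K} (hf : HS f a) (h : ∀ k, g k = f k) (e : b = a) :
    HS g b := by
  rw [e]; exact hf.congr h

lemma HS.unique {f : ℤ → K} {a b : K} (hf : HS f a) (hg : HS f b) : a = b :=
  hf.2.symm.trans hg.2

lemma HS.zero : HS (fun _ : ℤ => (0 : K)) 0 := ⟨by simp, by simp⟩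

lemma HS.single {f : ℤ → K} (c : ℤ) (h : ∀ k, k ≠ c → f k = 0) : HS f (f c) :=
  ⟨(Set.finite_singleton c).subset fun k hk => by
    by_contra hc; exact hk (h k hc), finsum_eq_single f c h⟩

/-- exchange of summations -/
lemma HS.swap {f : ℤ → ℤ → K} {u v : ℤ → K} {s : K} (hu : ∀ j, HS (fun k => f j k) (u j))
    (hv : ∀ k, HS (fun j => f j k) (v k)) (hs : HS u s) (B : ℤ)
    (hB : ∀ j k, f j k ≠ 0 → -B ≤ j ∧ j ≤ B ∧ -B ≤ k ∧ k ≤ B) : HS v s := by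
  have hv' : ∀ k, v k = ∑ j ∈ Finset.Icc (-B) B, f j k := fun k => by
    rw [← (hv k).2]
    refine finsum_eq_sum_of_support_subset _ fun j hj => ?_
    have := hB j k hj
    simp; omega
  have hu' : ∀ j, u j = ∑ k ∈ Finset.Icc (-B) B, f j k := fun j => by
    rw [← (hu j).2]
    refine finsum_eq_sum_of_support_subset _ fun k hj => ?_
    have := hB j k hj
    simp; omega
  have hvs : Function.support v ⊆ Finset.Icc (-B) B := fun k hk => by
    by_contra hc
    apply hk
    rw [hv']
    refine Finset.sum_eq_zero fun j _ => ?_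
    by_contra h0
    have := hB j k h0
    simp at hc; omega
  have hus : Function.support u ⊆ Finset.Icc (-B) B := fun k hk => by
    by_contra hc
    apply hk
    rw [hu']
    refine Finset.sum_eq_zero fun j _ => ?_
    by_contra h0
    have := hB k j h0
    simp at hc; omega
  refine ⟨(Finset.finite_toSet _).subset hvs, ?_⟩
  rw [finsum_eq_sum_of_support_subset _ hvs, ← hs.2, finsum_eq_sum_of_support_subset _ hus,
    Finset.sum_congr rfl fun k _ => hv' k, Finset.sum_congr rfl fun k _ => hu' k, Finset.sum_comm]

/-- the Burge summand -/
def bT (t : K) (A C n w k : ℤ) : K :=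
  t ^ (4 * (k * (k + n))) * hh t (A + C) (w - k) * hh t (A - k) k * hh t (C - n - k) (k + n)

lemma ne3 {a b c d : K} (h : a * b * c * d ≠ 0) : b ≠ 0 ∧ c ≠ 0 ∧ d ≠ 0 := by
  refine ⟨?_, ?_, ?_⟩ <;> rintro rfl <;> simp at h

lemma bT_HS (t : K) (A C n w : ℤ) : HS (bT t A C n w) (∑ᶠ k, bT t A C n w k) :=
  HS.mk 0 A fun k hk => by
    obtain ⟨h1, h2, h3⟩ := ne3 hk
    have := hh_ne t h2
    omega

section
variable {t : K}

lemma bT_rec (H : Good t) {A C n w : ℤ} (hA : 1 ≤ A) (hC : 0 ≤ C) (k : ℤ) :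
    bT t A C n w k = t ^ (4 * (A + C)) * bT t A C n (w - 1) k + bT t (A - 1) C n w k
      + t ^ (4 * (A + n)) * bT t (A - 1) C (n + 1) (w - 1) (k + (-1)) := by
  unfold bT
  rw [hh_pascal H (x := A + C) (u := w - k) (by omega), 
    show A + C - 1 = A - 1 + C by ring, show w - k - 1 = w - 1 - k by ring]
  have e1 := hh_pascal H (x := A - k) (u := k) (by omega)
  have e2 : t ^ (4 * (A + n)) * t ^ (4 * ((k + (-1)) * (k + n)))
    = t ^ (4 * (k * (k + n))) * t ^ (4 * (A - k)) := by
    rw [← zpow_add₀ H.1, ← zpow_add₀ H.1]; congr 1; ring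
  rw [show w - 1 - (k + (-1)) = w - k by ring, show A - 1 - (k + (-1)) = A - k by ring,
    show C - (n + 1) - (k + (-1)) = C - n - k by ring, show (k + (-1)) + (n + 1) = k + n by ring,
    show A - 1 - k = A - k - 1 by ring, show k + (-1) = k - 1 by ring]
  rw [show k + (-1) = k - 1 by ring] at e2
  linear_combination (t ^ (4 * (k * (k + n))) * hh t (A - 1 + C) (w - k) * hh t (C - n - k) (k + n)) * e1
    - hh t (A - 1 + C) (w - k) * hh t (A - k) (k - 1) * hh t (C - n - k) (k + n) * e2

lemma hh_prod_rec (H : Good t) {x y w v : ℤ} (hw : 1 ≤ w) (h : ¬ (y = 0 ∧ v = 0)) :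
    hh t x w * hh t y v = t ^ (4 * (x + y)) * (hh t x (w - 1) * hh t y (v - 1))
      + hh t (x - 1) w * hh t y v + t ^ (4 * x) * (hh t x (w - 1) * hh t (y - 1) v) := by
  rw [mul_add, zpow_add₀ H.1]
  linear_combination hh t y v * hh_pascal H (x := x) (u := w) (by omega)
   + t ^ (4 * x) * hh t x (w - 1) * hh_pascal H (x := y) (u := v) h

theorem burge (H : Good t) (A : ℕ) : ∀ (w : ℤ) (C n : ℤ), 0 ≤ C →
    HS (bT t A C n w) (hh t (A + n) w * hh t (C - n) (w + n)) := by
  induction A with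
  | zero =>
    intro w C n hC
    have := HS.single (f := bT t ((0 : ℕ) : ℤ) C n w) 0 (fun k hk => by
      unfold bT
      by_contra h
      obtain ⟨h1, h2, h3⟩ := ne3 h
      have := hh_ne t h2
      omega)
    convert this using 1
    unfold bT
    have := hh_tri H (C := C) (w := w) (n := n) hC
    simp only [Nat.cast_zero, zero_add, sub_zero, zero_mul, mul_zero, zpow_zero, one_mul,
      hh_zero_left H le_rfl, mul_one]
    exact this.symm
  | succ A ih =>
    have neg : ∀ (w : ℤ) (C n : ℤ), w < 0 → 
        HS (bT t ((A + 1 : ℕ) : ℤ) C n w) (hh t ((A + 1 : ℕ) + n) w * hh t (C - n) (w + n)) := by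
      intro w C n hw
      rw [hh_neg_right t hw, zero_mul]
      refine HS.zero.congr fun k => ?_
      by_contra h
      obtain ⟨h1, h2, h3⟩ := ne3 h
      have := hh_ne t h2
      have := hh_ne t h1
      omega
    intro w
    rcases lt_or_ge w 0 with hw | hw
    · exact fun C n _ => neg w C n hw
    lift w to ℕ using hw
    induction w with
    | zero =>
      intro C n hC
      have := HS.single (f := bT t ((A + 1 : ℕ) : ℤ) C n ((0 : ℕ) : ℤ)) 0 (fun k hk => by
        unfold bT
        by_contra h
        obtain ⟨h1, h2, h3⟩ := ne3 h
        have := hh_ne t h2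
        have := hh_ne t h1
        omega)
      convert this using 1
      unfold bT
      simp only [Nat.cast_zero, zero_add, sub_zero, zero_mul, mul_zero, zpow_zero, one_mul]
      rw [hh_zero_right H (u := ((A + 1 : ℕ) : ℤ)) (by omega), hh_zero_right H (u := ((A + 1 : ℕ) : ℤ) + C)
        (by omega), mul_one, one_mul]
      by_cases hn : n < 0
      · rw [hh_neg_right t hn, mul_zero]
      · rw [hh_zero_right H (by omega), one_mul]
    | succ w ihw =>
      intro C n hC
      have h1 := ihw C n hC
      have h2 := ih ((w + 1 : ℕ) : ℤ) C n hC
      have h3 := ih (((w + 1 : ℕ) : ℤ) - 1) C (n + 1) hC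
      have e1 : (((w + 1 : ℕ) : ℤ) - 1) = (w : ℤ) := by push_cast; ring
      have e2 : (((A + 1 : ℕ) : ℤ) - 1) = (A : ℤ) := by push_cast; ring
      have := ((h1.mul (t ^ (4 * (((A + 1 : ℕ) : ℤ) + C)))).add h2).add
        ((h3.shift (-1)).mul (t ^ (4 * (((A + 1 : ℕ) : ℤ) + n))))
      have := this.congr (g := bT t ((A + 1 : ℕ) : ℤ) C n ((w + 1 : ℕ) : ℤ)) (fun k => by
        rw [bT_rec H (by push_cast; omega) hC, e1, e2])
      convert this using 1
      by_cases hy : C - n = 0 ∧ ((w + 1 : ℕ) : ℤ) + n = 0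
      · exfalso; omega
      rw [hh_prod_rec H (by push_cast; omega) hy]
      push_cast
      ring_nf
end

/-- general summand -/
def gT (t : K) (δ s x y M j k : ℤ) : K :=
  t ^ (4 * (k * k + δ * k)) * hh t s (M - k) * hh t (x - k) (k - j) * hh t (y - k) (k + δ + j)

/-- edge conditions -/
def EC (x y j δ : ℤ) : Prop :=
  (0 ≤ x - j ∨ x + j + δ < 0 ∨ y - j < 0) ∧ (0 ≤ y + j + δ ∨ x + j + δ < 0 ∨ y - j < 0)

section
variable {t : K}

lemma BG (H : Good t) {x y M j δ : ℤ} (hE : EC x y j δ) :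
    HS (gT t δ (x + y + δ) x y M j)
      (t ^ (4 * (j * j + δ * j)) * (hh t (x + j + δ) (M - j) * hh t (y - j) (M + δ + j))) := by
  by_cases hA : 0 ≤ x - j
  · by_cases hC : 0 ≤ y + j + δ
    · obtain ⟨A, hA'⟩ : ∃ A : ℕ, x - j = A := ⟨(x - j).toNat, by omega⟩
      have := ((burge H A (M - j) (y + j + δ) (2 * j + δ) hC).shift (-j)).mul (t ^ (4 * (j * j + δ * j)))
      have := this.congr (g := gT t δ (x + y + δ) x y M j) (fun k => by
        unfold gT bT
        rw [← hA', ← mul_assoc, ← mul_assoc, ← mul_assoc, ← zpow_add₀ H.1]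
        ring_nf)
      convert this using 1
      rw [← hA']
      ring_nf
    · have h0 : hh t (x + j + δ) (M - j) * hh t (y - j) (M + δ + j) = 0 := by
        rcases hE.2 with h | h | h
        · omega
        · rw [hh_neg_left t h, zero_mul]
        · rw [hh_neg_left t h, mul_zero]
      rw [h0, mul_zero]
      refine HS.zero.congr fun k => ?_
      by_contra h
      obtain ⟨h1, h2, h3⟩ := ne3 h
      have := hh_ne t h3
      omega
  · have h0 : hh t (x + j + δ) (M - j) * hh t (y - j) (M + δ + j) = 0 := by
      rcases hE.1 with h | h | h
      · omega
      · rw [hh_neg_left t h, zero_mul]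
      · rw [hh_neg_left t h, mul_zero]
    rw [h0, mul_zero]
    refine HS.zero.congr fun k => ?_
    by_contra h
    obtain ⟨h1, h2, h3⟩ := ne3 h
    have := hh_ne t h2
    omega

/-- bosonic summand -/
def phiT (t : K) (P a b c M δ j : ℤ) : K :=
  t ^ (4 * (j * (P * j + b))) * (hh t (P * j + b + c) (M - j) * hh t (a + c - P * j) (M + δ + j)
    - hh t (P * j + a + b + c) (M - j) * hh t (c - P * j) (M + δ + j))

/-- bosonic form -/
def Phi (t : K) (P a b c M δ : ℤ) : K := ∑ᶠ j, phiT t P a b c M δ j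

lemma phiT_ne {P a b c M δ j : ℤ} (h : phiT t P a b c M δ j ≠ 0) : j ≤ M ∧ 0 ≤ M + δ + j := by
  by_contra hc
  apply h
  unfold phiT
  by_cases h1 : j ≤ M
  · rw [hh_neg_right t (u := M + δ + j) (by omega), hh_neg_right t (u := M + δ + j) (by omega)]; simp
  · rw [hh_neg_right t (u := M - j) (by omega), hh_neg_right t (u := M - j) (by omega)]; simp

lemma Phi_HS (t : K) (P a b c M δ : ℤ) : HS (phiT t P a b c M δ) (Phi t P a b c M δ) :=
  HS.mk (-M - δ) M fun j hj => by have := phiT_ne hj; omega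

lemma Phi_neg (t : K) (P a b c : ℤ) {M δ : ℤ} (h : 2 * M + δ < 0) : Phi t P a b c M δ = 0 := by
  refine (Phi_HS t P a b c M δ).unique (HS.zero.congr fun j => ?_)
  by_contra hc
  have := phiT_ne hc
  omega

/-- general exchange lemma for steps -/
lemma step_gen {P a b c M δ e ε s : ℤ} {u : ℤ → K} {S : K}
    (hu : ∀ j, HS (fun k => t ^ (4 * (k * k + ε * k)) * hh t s (M - k)
      * phiT t P a b (c - k) (k + e) δ j) (u j)) (hS : HS u S) :
    HS (fun k => t ^ (4 * (k * k + ε * k)) * hh t s (M - k) * Phi t P a b (c - k) (k + e) δ) S := by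
  refine HS.swap (f := fun j k => t ^ (4 * (k * k + ε * k)) * hh t s (M - k)
      * phiT t P a b (c - k) (k + e) δ j) hu (fun k => (Phi_HS t P a b (c - k) (k + e) δ).mul _)
      hS (|M| + |e| + |e| + |δ|) ?_
  intro j k h
  have h1 := phiT_ne (right_ne_zero_of_mul h)
  have h2 := hh_ne t (right_ne_zero_of_mul (left_ne_zero_of_mul h))
  have := le_abs_self M
  have := neg_abs_le M
  have := le_abs_self e
  have := neg_abs_le e
  have := le_abs_self δ
  have := neg_abs_le δ
  omega

lemma j_cases (P j : ℤ) (hP : 2 ≤ P) : (1 ≤ j ∧ P ≤ P * j ∧ 2 * (j - 1) ≤ P * j - P) ∨ (j = 0 ∧ P * j = 0) ∨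
    (j ≤ -1 ∧ P * j ≤ - P ∧ P * j + P ≤ 2 * (j + 1)) := by
  rcases lt_trichotomy j 0 with h | h | h
  · right; right
    exact ⟨by omega, by nlinarith, by nlinarith⟩
  · right; left
    subst h; simp
  · left
    exact ⟨by omega, by nlinarith, by nlinarith⟩

theorem step_plain (H : Good t) {P a b c M δ : ℤ} (hP : 2 ≤ P) (ha : 1 ≤ a) (ha' : a ≤ P - 1)
    (hb : 1 ≤ b) (hb' : b ≤ P - 1) (hδ : δ = 0 ∨ (δ = 1 ∧ a + 1 ≤ b)) (hl : 0 ≤ a + b + δ + 2 * c) :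
    HS (fun k => t ^ (4 * (k * k + δ * k)) * hh t (a + b + δ + 2 * c) (M - k)
      * Phi t P a b (c - k) k δ) (Phi t (P + 1) a (b + δ) c M δ) := by
  have := step_gen (t := t) (P := P) (a := a) (b := b) (c := c) (M := M) (δ := δ) (e := 0) (ε := δ)
    (s := a + b + δ + 2 * c) (u := phiT t (P + 1) a (b + δ) c M δ) ?_ (Phi_HS _ _ _ _ _ _ _)
  · simpa using this
  intro j
  have E1 : EC (P * j + b + c) (a + c - P * j) j δ := by
    unfold EC
    have := j_cases P j hP
    omega
  have E2 : EC (P * j + a + b + c) (c - P * j) j δ := by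
    unfold EC
    have := j_cases P j hP
    omega
  have := ((BG H (M := M) E1).sub (BG H (M := M) E2)).mul (t ^ (4 * (j * (P * j + b))))
  refine this.congr2 (fun k => ?_) ?_
  · unfold gT phiT
    ring_nf
  · unfold phiT
    rw [show t ^ (4 * (j * ((P + 1) * j + (b + δ)))) = t ^ (4 * (j * (P * j + b))) *
      t ^ (4 * (j * j + δ * j)) by rw [← zpow_add₀ H.1]; ring_nf]
    ring_nf
end

section
variable {t : K}

lemma zpow_hadd (H : Good t) {a b c : ℤ} (h : a = b + c) : t ^ a = t ^ b * t ^ c := by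
  rw [h, zpow_add₀ H.1]

lemma SB1 (H : Good t) {x y M j : ℤ} (h1 : EC x (y - 1) j 1) (h2 : EC x y j 0)
    (h3 : ¬ (y = -1 - j ∧ j ≤ -1 ∧ y ≤ x)) :
    HS (fun k => t ^ (4 * (k * k)) * hh t (x + y) (M - k) * hh t (x - k) (k - j)
        * hh t (y - k) (k + 1 + j))
      (t ^ (4 * (j * j)) * (hh t (x + j) (M - j) * hh t (y - j) (M + j))
        + t ^ (4 * ((j + 1) * (j + 1))) *
          (hh t (x + j + 1) (M - j) * hh t (y - j - 1) (M + j + 1))) := by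
  refine ((BG H (M := M) h2).add ((BG H (M := M) h1).mul (t ^ (4 * (j + 1))))).congr2
    (fun k => ?_) ?_
  · unfold gT
    by_cases hx : x - k < 0 ∨ k - j < 0
    · have : hh t (x - k) (k - j) = 0 := by
        rcases hx with h | h
        · exact hh_neg_left t h
        · exact hh_neg_right t h
      rw [this]; ring
    · rw [hh_pascal' H (x := y - k) (u := k + 1 + j) (by omega)]
      rw [zpow_hadd H (show 4 * (k * k + 1 * k) = 4 * (k * k) + 4 * k by ring),
        zpow_hadd H (show 4 * (k + 1 + j) = 4 * k + 4 * (j + 1) by ring)]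
      ring_nf
  · rw [zpow_hadd H (show 4 * ((j + 1) * (j + 1)) = 4 * (j + 1) + 4 * (j * j + 1 * j) by ring)]
    ring_nf

lemma SB2gen (H : Good t) {s x y M j : ℤ} {A B : K} (h1 : HS (gT t 0 s x (y + 1) (M + 1) j) A)
    (h2 : HS (gT t 1 s x y M j) B) (h3 : ¬ (x = j - 1 ∧ 0 ≤ j ∧ x ≤ y)) :
    HS (fun k => t ^ (4 * (k * k + 1 * k)) * hh t s (M - k) * hh t (x - k) (k + 1 - j)
        * hh t (y - k) (k + 1 + j))
      (B + t ^ (4 * (-j)) * A) := by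
  refine (h2.add ((h1.shift 1).mul (t ^ (4 * (-j))))).congr2 (fun k => ?_) rfl
  unfold gT
  by_cases hx : y - k < 0 ∨ k + 1 + j < 0
  · have : hh t (y - k) (k + 1 + j) = 0 := by
      rcases hx with h | h
      · exact hh_neg_left t h
      · exact hh_neg_right t h
    have h' : hh t (y + 1 - (k + 1)) (k + 1 + 0 + j) = 0 := by
      rw [← this]; ring_nf
    rw [this, h']; ring
  · rw [hh_pascal' H (x := x - k) (u := k + 1 - j) (by omega)]
    rw [zpow_hadd H (show 4 * ((k + 1) * (k + 1) + 0 * (k + 1)) = 4 * (k * k + 1 * k) + 4 * (k + 1 - j) + 4 * j by ring),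
      zpow_hadd H (show 4 * (k * k + 1 * k) + 4 * (k + 1 - j) = 4 * (k * k + 1 * k) + 4 * (k + 1 - j) by ring)]
    have e : t ^ (4 * (-j)) * t ^ (4 * j) = 1 := by
      rw [← zpow_add₀ H.1]; simp
    ring_nf at e ⊢
    linear_combination (-(t ^ (k * 4 + k ^ 2 * 4) * hh t s (-k + M) * t ^ (4 - j * 4 + k * 4) *
      hh t (-1 - k + x) (1 - j + k) * hh t (-k + y) (1 + j + k))) * e

/-- the bracket -/
def brk (t : K) (p r U V : ℤ) : K :=
  hh t p U * hh t r V - t ^ (4 * (p + r)) * (hh t p (U - 1) * hh t r (V - 1))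

lemma SA (H : Good t) {δ s x y M j : ℤ} (h : EC x y j δ) (hs : s = x + y + δ - 1) (hs0 : 0 ≤ s) :
    HS (gT t δ s x y M j)
      (t ^ (4 * (j * j + δ * j)) * brk t (x + j + δ) (y - j) (M - j) (M + δ + j)) := by
  refine ((BG H (M := M) h).sub ((BG H (M := M - 1) h).mul (t ^ (4 * (x + y + δ))))).congr2
    (fun k => ?_) ?_
  · unfold gT
    have := hh_pascal H (x := x + y + δ) (u := M - k) (by omega)
    rw [show x + y + δ - 1 = s by omega, show M - k - 1 = M - 1 - k by ring] at this
    rw [this]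
    ring
  · unfold brk
    ring_nf

lemma brk_plus (H : Good t) {p r U V : ℤ} (h1 : ¬ (r = 0 ∧ V = 0 ∧ 0 ≤ p ∧ 0 ≤ U))
    (h2 : ¬ (p = 0 ∧ U = 0 ∧ 0 ≤ r ∧ 1 ≤ V)) :
    brk t p r U V = t ^ (4 * r) * (hh t (p - 1) U * hh t r (V - 1)) + hh t p U * hh t (r - 1) V := by
  unfold brk
  have e1 : hh t p U * hh t r V = hh t p U * (hh t (r - 1) V + t ^ (4 * r) * hh t r (V - 1)) := by
    by_cases h : 0 ≤ p ∧ 0 ≤ U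
    · rw [hh_pascal H (x := r) (u := V) (by omega)]
    · have : hh t p U = 0 := by
        by_contra hc; exact h (hh_ne t hc)
      rw [this]; ring
  have e2 : hh t p U * hh t r (V - 1) = (hh t (p - 1) U + t ^ (4 * p) * hh t p (U - 1)) *
      hh t r (V - 1) := by
    by_cases h : 0 ≤ r ∧ 0 ≤ V - 1
    · rw [hh_pascal H (x := p) (u := U) (by omega)]
    · have : hh t r (V - 1) = 0 := by
        by_contra hc; exact h (hh_ne t hc)
      rw [this]; ring
  rw [zpow_hadd H (show 4 * (p + r) = 4 * p + 4 * r by ring)]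
  linear_combination e1 + t ^ (4 * r) * e2

lemma brk_comm (t : K) (p r U V : ℤ) : brk t p r U V = brk t r p V U := by
  unfold brk; ring_nf

lemma brk_minus (H : Good t) {p r U V : ℤ} (h1 : ¬ (p = 0 ∧ U = 0 ∧ 0 ≤ r ∧ 0 ≤ V))
    (h2 : ¬ (r = 0 ∧ V = 0 ∧ 0 ≤ p ∧ 1 ≤ U)) :
    brk t p r U V = t ^ (4 * p) * (hh t p (U - 1) * hh t (r - 1) V) + hh t (p - 1) U * hh t r V := by
  rw [brk_comm, brk_plus H h1 h2]; ring
end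

section
variable {t : K}

lemma HS.antisymm_refl {T : ℤ → K} {s : K} (c : ℤ) (h : HS T s) : HS (fun j => T j - T (c - j)) 0 :=
  (h.sub (h.refl c)).congr2 (fun _ => rfl) (by ring)

lemma aux_split (X i A B A' B' : K) :
    X * (B + i * A - (B' + i * A')) = X * B - X * B' + ((X * i) * A - (X * i) * A') := by ring

theorem step_b1 (H : Good t) {P a c M : ℤ} (hP : 2 ≤ P) (ha : 1 ≤ a) (ha' : a ≤ P - 1) 
    (hl : 0 ≤ a + (P - 1) + 2 * c) :
    HS (fun k => t ^ (4 * (k * k)) * hh t (a + (P - 1) + 2 * c) (M - k)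
      * Phi t P a (P - 1) (c - k) k 1) (Phi t (P + 1) a (P - 1) c M 0) := by
  let T : ℤ → K := fun j => t ^ (4 * (j * (P * j + (P - 1)) + (j + 1) * (j + 1))) *
    (hh t (P * j + (P - 1) + c + j + 1) (M - j) * hh t (a + c - P * j - j - 1) (M + j + 1))
  have hT : HS T (∑ᶠ j, T j) := HS.mk (-M - 1) M fun j hj => by
    have h1 := hh_ne t (left_ne_zero_of_mul (right_ne_zero_of_mul hj))
    have h2 := hh_ne t (right_ne_zero_of_mul (right_ne_zero_of_mul hj))
    omega
  have := step_gen (t := t) (P := P) (a := a) (b := P - 1) (c := c) (M := M) (δ := 1) (e := 0) (ε := 0)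
    (s := a + (P - 1) + 2 * c) (u := fun j => phiT t (P + 1) a (P - 1) c M 0 j + (T j - T (-1 - j)))
    ?_ ((Phi_HS _ _ _ _ _ _ _).add (hT.antisymm_refl _))
  · simpa using this
  intro j
  have E1 : EC (P * j + (P - 1) + c) (a + c - P * j - 1) j 1 := by
    unfold EC
    have := j_cases P j hP
    omega
  have E2 : EC (P * j + (P - 1) + c) (a + c - P * j) j 0 := by
    unfold EC
    have := j_cases P j hP
    omega
  have E3 : ¬ (a + c - P * j = -1 - j ∧ j ≤ -1 ∧ a + c - P * j ≤ P * j + (P - 1) + c) := by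
    have := j_cases P j hP
    omega
  have F1 : EC (P * j + a + (P - 1) + c) (c - P * j - 1) j 1 := by
    unfold EC
    have := j_cases P j hP
    omega
  have F2 : EC (P * j + a + (P - 1) + c) (c - P * j) j 0 := by
    unfold EC
    have := j_cases P j hP
    omega
  have F3 : ¬ (c - P * j = -1 - j ∧ j ≤ -1 ∧ c - P * j ≤ P * j + a + (P - 1) + c) := by
    have := j_cases P j hP
    omega
  refine (((SB1 H (M := M) E1 E2 E3).sub (SB1 H (M := M) F1 F2 F3)).mul
    (t ^ (4 * (j * (P * j + (P - 1)))))).congr2 (fun k => ?_) ?_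
  · unfold phiT
    ring_nf
  · unfold phiT T
    rw [zpow_hadd H (show 4 * (j * ((P + 1) * j + (P - 1))) = 4 * (j * (P * j + (P - 1)))
        + 4 * (j * j) by ring),
      zpow_hadd H (show 4 * ((-1 - j) * (P * (-1 - j) + (P - 1)) + ((-1 - j) + 1) * ((-1 - j) + 1))
        = 4 * (j * (P * j + (P - 1))) + 4 * ((j + 1) * (j + 1)) by ring),
      zpow_hadd H (show 4 * (j * (P * j + (P - 1)) + (j + 1) * (j + 1))
        = 4 * (j * (P * j + (P - 1))) + 4 * ((j + 1) * (j + 1)) by ring)]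
    ring_nf

theorem step_b2 (H : Good t) {P c M : ℤ} (hP : 2 ≤ P) (hl : 0 ≤ 3 + 2 * c) :
    HS (fun k => t ^ (4 * (k * k + 1 * k)) * hh t (3 + 2 * c) (M - k)
      * Phi t P 1 1 (c - k) (k + 1) 0) (Phi t (P + 1) 1 2 c M 1) := by
  let T : ℤ → K := fun j => t ^ (4 * ((P + 1) * j * j)) *
    (hh t (P * j + 1 + c + j) (M + 1 - j) * hh t (1 + c - P * j + 1 - j) (M + 1 + j))
  have hT : HS T (∑ᶠ j, T j) := HS.mk (-M - 1) (M + 1) fun j hj => by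
    have h1 := hh_ne t (left_ne_zero_of_mul (right_ne_zero_of_mul hj))
    have h2 := hh_ne t (right_ne_zero_of_mul (right_ne_zero_of_mul hj))
    omega
  refine step_gen (u := fun j => phiT t (P + 1) 1 2 c M 1 j + (T j - T (0 - j)))
    ?_ (((Phi_HS _ _ _ _ _ _ _).add (hT.antisymm_refl _)).congr2 (fun _ => rfl) (by simp))
  intro j
  have E1 : EC (P * j + 1 + c) (1 + c - P * j + 1) j 0 := by
    unfold EC
    have := j_cases P j hP
    omega
  have E2 : EC (P * j + 1 + c) (1 + c - P * j) j 1 := by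
    unfold EC
    have := j_cases P j hP
    omega
  have E3 : ¬ (P * j + 1 + c = j - 1 ∧ 0 ≤ j ∧ P * j + 1 + c ≤ 1 + c - P * j) := by
    have := j_cases P j hP
    omega
  have F1 : EC (P * j + 1 + 1 + c) (c - P * j + 1) j 0 := by
    unfold EC
    have := j_cases P j hP
    omega
  have F2 : EC (P * j + 1 + 1 + c) (c - P * j) j 1 := by
    unfold EC
    have := j_cases P j hP
    omega
  have F3 : ¬ (P * j + 1 + 1 + c = j - 1 ∧ 0 ≤ j ∧ P * j + 1 + 1 + c ≤ c - P * j) := by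
    have := j_cases P j hP
    omega
  have X1 := SB2gen H (s := 3 + 2 * c) (M := M) ((BG H (M := M + 1) E1).congr fun k => by ring_nf)
    ((BG H (M := M) E2).congr fun k => by ring_nf) E3
  have X2 := SB2gen H (s := 3 + 2 * c) (M := M) ((BG H (M := M + 1) F1).congr fun k => by ring_nf)
    ((BG H (M := M) F2).congr fun k => by ring_nf) F3
  refine ((X1.sub X2).mul (t ^ (4 * (j * (P * j + 1))))).congr2 (fun k => ?_) ?_
  · unfold phiT
    ring_nf
  · unfold phiT T
    have e : t ^ (4 * (j * (P * j + 1))) * t ^ (4 * (-j)) = t ^ (4 * (P * j * j)) := by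
      rw [← zpow_add₀ H.1]; ring_nf
    rw [aux_split, e]
    rw [zpow_hadd H (show 4 * (j * ((P + 1) * j + 2)) = 4 * (j * (P * j + 1))
        + 4 * (j * j + 1 * j) by ring),
      zpow_hadd H (show 4 * ((P + 1) * j * j)
        = 4 * (P * j * j) + 4 * (j * j + 0 * j) by ring),
      zpow_hadd H (show 4 * ((P + 1) * (0 - j) * (0 - j))
        = 4 * (P * j * j) + 4 * (j * j + 0 * j) by ring)]
    ring_nf

/-- value part of the a-step -/
lemma astep_val (H : Good t) {P b c M δ : ℤ} (hP : 2 ≤ P) (hb : 1 ≤ b) (hb' : b ≤ P - 1)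
    (hδ : δ = 0 ∨ δ = 1) (hl : 0 ≤ b + 2 * c + δ) (hbδ : δ = 0 → b = 1) :
    HS (fun j => t ^ (4 * (j * (P * j + b))) * (t ^ (4 * (j * j + δ * j)) *
        brk t (P * j + b + c + j + δ) (1 + c - P * j - j) (M - j) (M + δ + j)
      - t ^ (4 * (j * j + δ * j)) *
        brk t (P * j + 1 + b + c + j + δ) (c - P * j - j) (M - j) (M + δ + j)))
      (t ^ (4 * (c + 1)) * Phi t (P + 1) (P - 1) (P + 1 - b - δ) (c + b + δ - P) (M + δ - 1) (1 - δ)) := by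
  let G : ℤ → K := fun j => t ^ (4 * (j * ((P + 1) * j + (P + 1 - b - δ)))) *
    (hh t ((P + 1) * j + (P + 1 - b - δ) + (c + b + δ - P)) ((M + δ - 1) - j)
      * hh t ((P - 1) + (c + b + δ - P) - (P + 1) * j) ((M + δ - 1) + (1 - δ) + j))
  let G' : ℤ → K := fun j => t ^ (4 * (j * ((P + 1) * j + (P + 1 - b - δ)))) *
    (hh t ((P + 1) * j + (P - 1) + (P + 1 - b - δ) + (c + b + δ - P)) ((M + δ - 1) - j)
      * hh t ((c + b + δ - P) - (P + 1) * j) ((M + δ - 1) + (1 - δ) + j))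
  have hG : HS G (∑ᶠ j, G j) := HS.mk (-M) (M + δ - 1) fun j hj => by
    have h1 := hh_ne t (left_ne_zero_of_mul (right_ne_zero_of_mul hj))
    have h2 := hh_ne t (right_ne_zero_of_mul (right_ne_zero_of_mul hj))
    omega
  have hG' : HS G' (∑ᶠ j, G' j) := HS.mk (-M) (M + δ - 1) fun j hj => by
    have h1 := hh_ne t (left_ne_zero_of_mul (right_ne_zero_of_mul hj))
    have h2 := hh_ne t (right_ne_zero_of_mul (right_ne_zero_of_mul hj))
    omega
  have hPhi : Phi t (P + 1) (P - 1) (P + 1 - b - δ) (c + b + δ - P) (M + δ - 1) (1 - δ)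
      = (∑ᶠ j, G j) - (∑ᶠ j, G' j) := by
    refine (Phi_HS _ _ _ _ _ _ _).unique ((hG.sub hG').congr fun j => ?_)
    unfold phiT G G'
    ring
  rw [hPhi]
  refine (((hG.refl 0).sub (hG'.refl (-1))).mul (t ^ (4 * (c + 1)))).congr fun j => ?_
  rw [brk_plus H, brk_minus H]
  · unfold G G'
    have e1 : t ^ (4 * (c + 1)) * t ^ (4 * ((0 - j) * ((P + 1) * (0 - j) + (P + 1 - b - δ)))) =
      t ^ (4 * (j * (P * j + b))) * t ^ (4 * (j * j + δ * j)) * t ^ (4 * (1 + c - P * j - j)) := by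
      rw [← zpow_add₀ H.1, ← zpow_add₀ H.1, ← zpow_add₀ H.1]; ring_nf
    have e2 : t ^ (4 * (c + 1)) * t ^ (4 * ((-1 - j) * ((P + 1) * (-1 - j) + (P + 1 - b - δ)))) =
      t ^ (4 * (j * (P * j + b))) * t ^ (4 * (j * j + δ * j)) * t ^ (4 * (P * j + 1 + b + c + j + δ)) := by
      rw [← zpow_add₀ H.1, ← zpow_add₀ H.1, ← zpow_add₀ H.1]; ring_nf
    rw [mul_sub (t ^ (4 * (c + 1))), ← mul_assoc (t ^ (4 * (c + 1))), ← mul_assoc (t ^ (4 * (c + 1))), e1, e2]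
    generalize t ^ (4 * (j * (P * j + b))) = X
    generalize t ^ (4 * (j * j + δ * j)) = X
    generalize t ^ (4 * (1 + c - P * j - j)) = X
    generalize t ^ (4 * (P * j + 1 + b + c + j + δ)) = X
    ring_nf
  · have := j_cases P j hP
    omega
  · have := j_cases P j hP
    omega
  · have := j_cases P j hP
    omega
  · have := j_cases P j hP
    omega

theorem step_a (H : Good t) {P b c M δ : ℤ} (hP : 2 ≤ P) (hb : 1 ≤ b) (hb' : b ≤ P - 1)
    (hδ : δ = 0 ∨ δ = 1) (hl : 0 ≤ b + 2 * c + δ) (hbδ : δ = 0 → b = 1) :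
    HS (fun k => t ^ (4 * (k * k + δ * k)) * hh t (b + 2 * c + δ) (M - k) * Phi t P 1 b (c - k) k δ)
      (t ^ (4 * (c + 1)) * Phi t (P + 1) (P - 1) (P + 1 - b - δ) (c + b + δ - P) (M + δ - 1) (1 - δ)) := by
  have := step_gen (t := t) (P := P) (a := 1) (b := b) (c := c) (M := M) (δ := δ) (e := 0) (ε := δ)
    (s := b + 2 * c + δ) ?_ (astep_val H (M := M) hP hb hb' hδ hl hbδ)
  · simpa using this
  intro j
  have E1 : EC (P * j + b + c) (1 + c - P * j) j δ := by
    unfold EC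
    have := j_cases P j hP
    omega
  have E2 : EC (P * j + 1 + b + c) (c - P * j) j δ := by
    unfold EC
    have := j_cases P j hP
    omega
  refine (((SA H (s := b + 2 * c + δ) (M := M) E1 (by ring) hl).sub
    (SA H (s := b + 2 * c + δ) (M := M) E2 (by ring) hl)).mul (t ^ (4 * (j * (P * j + b))))).congr2
    (fun k => ?_) ?_
  · unfold gT phiT
    ring_nf
  · ring_nf

theorem step_ab (H : Good t) {P c M : ℤ} (hP : 2 ≤ P) (hl : 0 ≤ 2 + 2 * c) :
    HS (fun k => t ^ (4 * (k * k + 1 * k)) * hh t (2 + 2 * c) (M - k) * Phi t P 1 1 (c - k) (k + 1) 0)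
      (t ^ (4 * (c + 1)) * Phi t (P + 1) (P - 1) (P - 1) (c + 2 - P) M 0) := by
  let T : ℤ → K := fun j => t ^ (4 * ((P + 1) * j * j)) *
    brk t (P * j + 1 + c + j) (1 + c - P * j + 1 - j) (M + 1 - j) (M + 1 + j)
  have hT : HS T (∑ᶠ j, T j) := HS.mk (-M - 1) (M + 1) fun j hj => by
    by_contra hc
    apply hj
    unfold T brk
    by_cases h : M + 1 < j
    · rw [hh_neg_right t (u := M + 1 - j) (by omega), hh_neg_right t (u := M + 1 - j - 1) (by omega)]
      ring
    · rw [hh_neg_right t (u := M + 1 + j) (by omega), hh_neg_right t (u := M + 1 + j - 1) (by omega)]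
      ring
  refine step_gen ?_ (((astep_val H (P := P) (b := 1) (c := c) (M := M) (δ := 1) hP le_rfl (by omega)
    (Or.inr rfl) (by omega) (by omega)).add (hT.antisymm_refl 0)).congr2 (fun _ => rfl) ?_)
  swap
  · ring_nf
  intro j
  have E1 : EC (P * j + 1 + c) (1 + c - P * j + 1) j 0 := by
    unfold EC
    have := j_cases P j hP
    omega
  have E2 : EC (P * j + 1 + c) (1 + c - P * j) j 1 := by
    unfold EC
    have := j_cases P j hP
    omega
  have E3 : ¬ (P * j + 1 + c = j - 1 ∧ 0 ≤ j ∧ P * j + 1 + c ≤ 1 + c - P * j) := by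
    have := j_cases P j hP
    omega
  have F1 : EC (P * j + 1 + 1 + c) (c - P * j + 1) j 0 := by
    unfold EC
    have := j_cases P j hP
    omega
  have F2 : EC (P * j + 1 + 1 + c) (c - P * j) j 1 := by
    unfold EC
    have := j_cases P j hP
    omega
  have F3 : ¬ (P * j + 1 + 1 + c = j - 1 ∧ 0 ≤ j ∧ P * j + 1 + 1 + c ≤ c - P * j) := by
    have := j_cases P j hP
    omega
  have X1 := SB2gen H (s := 2 + 2 * c) (M := M) (SA H (s := 2 + 2 * c) (M := M + 1) E1 (by ring) hl)
    (SA H (s := 2 + 2 * c) (M := M) E2 (by ring) hl) E3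
  have X2 := SB2gen H (s := 2 + 2 * c) (M := M) (SA H (s := 2 + 2 * c) (M := M + 1) F1 (by ring) hl)
    (SA H (s := 2 + 2 * c) (M := M) F2 (by ring) hl) F3
  refine ((X1.sub X2).mul (t ^ (4 * (j * (P * j + 1))))).congr2 (fun k => ?_) ?_
  · unfold phiT
    ring_nf
  · unfold T
    have e : t ^ (4 * (j * (P * j + 1))) * t ^ (4 * (-j)) = t ^ (4 * (P * j * j)) := by
      rw [← zpow_add₀ H.1]; ring_nf
    have e2 : brk t (P * (0 - j) + 1 + c + (0 - j)) (1 + c - P * (0 - j) + 1 - (0 - j)) (M + 1 - (0 - j))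
        (M + 1 + (0 - j)) = brk t (P * j + 1 + 1 + c + j + 0) (c - P * j + 1 - j) (M + 1 - j) (M + 1 + 0 + j) := by
      rw [brk_comm]; ring_nf
    rw [e2]
    rw [aux_split (t ^ (4 * (j * (P * j + 1)))) (t ^ (4 * (-j))), e]
    rw [zpow_hadd H (show 4 * ((P + 1) * j * j)
        = 4 * (P * j * j) + 4 * (j * j + 0 * j) by ring),
      zpow_hadd H (show 4 * ((P + 1) * (0 - j) * (0 - j))
        = 4 * (P * j * j) + 4 * (j * j + 0 * j) by ring)]
    ring_nf
end

section
variable {t : K}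

lemma Phi_lneg (t : K) (P M δ : ℤ) {a b c : ℤ} (h : a + b + 2 * c < 0) :
    Phi t P a b c M δ = 0 := by
  refine (Phi_HS t P a b c M δ).unique (HS.zero.congr fun j => ?_)
  unfold phiT
  have e1 : hh t (P * j + b + c) (M - j) * hh t (a + c - P * j) (M + δ + j) = 0 := by
    by_cases hx : P * j + b + c < 0
    · rw [hh_neg_left t hx, zero_mul]
    · rw [hh_neg_left t (x := a + c - P * j) (by omega), mul_zero]
  have e2 : hh t (P * j + a + b + c) (M - j) * hh t (c - P * j) (M + δ + j) = 0 := by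
    by_cases hx : P * j + a + b + c < 0
    · rw [hh_neg_left t hx, zero_mul]
    · rw [hh_neg_left t (x := c - P * j) (by omega), mul_zero]
  rw [e1, e2]; ring

lemma base_rec (H : Good t) {c M : ℤ} (hc : 0 ≤ c) :
    Phi t 2 1 1 c M 0 = t ^ (4 * (2 + 2 * c)) * Phi t 2 1 1 c (M - 1) 0 := by
  rw [← sub_eq_zero]
  refine ((Phi_HS t 2 1 1 c M 0).sub ((Phi_HS t 2 1 1 c (M - 1) 0).mul _)).unique ?_
  let T : ℤ → K := fun j => t ^ (4 * (2 * j * j - j + c + 1)) *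
    (hh t (2 * j + c) (M - j) * hh t (1 + c - 2 * j) (M + j - 1))
  have hT : HS T (∑ᶠ j, T j) := HS.mk (-M + 1) M fun j hj => by
    have h1 := hh_ne t (left_ne_zero_of_mul (right_ne_zero_of_mul hj))
    have h2 := hh_ne t (right_ne_zero_of_mul (right_ne_zero_of_mul hj))
    omega
  refine (hT.sub (hT.shift 1)).congr2 (fun j => ?_) (by ring)
  have B1 := brk_plus H (p := 2 * j + 1 + c) (r := 1 + c - 2 * j) (U := M - j) (V := M + j)
    (by omega) (by omega)
  have B2 := brk_minus H (p := 2 * j + 2 + c) (r := c - 2 * j) (U := M - j) (V := M + j)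
    (by omega) (by omega)
  unfold brk at B1 B2
  have e1 : t ^ (4 * (2 * j * j - j + c + 1)) = t ^ (4 * (j * (2 * j + 1))) * t ^ (4 * (1 + c - 2 * j)) := by
    rw [← zpow_add₀ H.1]; ring_nf
  have e2 : t ^ (4 * (2 * (j + 1) * (j + 1) - (j + 1) + c + 1)) = t ^ (4 * (j * (2 * j + 1))) * t ^ (4 * (2 * j + 2 + c)) := by
    rw [← zpow_add₀ H.1]; ring_nf
  unfold phiT T
  rw [e1, e2]
  rw [show 2 * j + 1 + c + (1 + c - 2 * j) = 2 + 2 * c by ring] at B1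
  rw [show 2 * j + 2 + c + (c - 2 * j) = 2 + 2 * c by ring] at B2
  rw [show 2 * j + 1 + c - 1 = 2 * j + c by ring, show 1 + c - 2 * j - 1 = c - 2 * j by ring] at B1
  rw [show 2 * j + 2 + c - 1 = 2 * j + 1 + c by ring] at B2
  rw [show 2 * j + 1 + 1 + c = 2 * j + 2 + c by ring, show M + 0 + j = M + j by ring, 
    show M - 1 + 0 + j = M + j - 1 by ring, show M - 1 - j = M - j - 1 by ring,
    show 2 * (j + 1) + c = 2 * j + 2 + c by ring, show M - (j + 1) = M - j - 1 by ring,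
    show 1 + c - 2 * (j + 1) = c - 2 * j - 1 by ring, show M + (j + 1) - 1 = M + j by ring]
  linear_combination t ^ (4 * (j * (2 * j + 1))) * (B1 - B2)

lemma base_zero (H : Good t) {c : ℤ} (hc : 0 ≤ c) (M : ℤ) : Phi t 2 1 1 c M 0 = 0 := by
  by_cases hM : M < 0
  · exact Phi_neg _ _ _ _ _ (by omega)
  lift M to ℕ using by omega
  induction M with
  | zero => rw [base_rec H hc, Phi_neg _ _ _ _ _ (by simp), mul_zero]
  | succ M ih =>
    rw [base_rec H hc]
    push_cast
    rw [add_sub_cancel_right, ih (by omega), mul_zero]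

lemma base_one (H : Good t) {M : ℤ} (hM : 0 ≤ M) : Phi t 2 1 1 (-1) M 0 = 1 := by
  refine (Phi_HS t 2 1 1 (-1) M 0).unique ((HS.single 0 ?_).congr2 (fun _ => rfl) ?_)
  · intro j hj
    unfold phiT
    have e1 : hh t (2 * j + 1 + -1) (M - j) * hh t (1 + -1 - 2 * j) (M + 0 + j) = 0 := by
      by_cases hx : 2 * j + 1 + -1 < 0
      · rw [hh_neg_left t hx, zero_mul]
      · rw [hh_neg_left t (x := 1 + -1 - 2 * j) (by omega), mul_zero]
    have e2 : hh t (2 * j + 1 + 1 + -1) (M - j) * hh t (-1 - 2 * j) (M + 0 + j) = 0 := by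
      by_cases hx : 2 * j + 1 + 1 + -1 < 0
      · rw [hh_neg_left t hx, zero_mul]
      · rw [hh_neg_left t (x := -1 - 2 * j) (by omega), mul_zero]
    rw [e1, e2]; ring
  · unfold phiT
    simp [hh_zero_left H hM, hh_neg_left t (show (-1 : ℤ) < 0 by norm_num)]

/-- indicator -/
def ind (p : Prop) : ℤ := if p then 1 else 0

/-- fermionic recursion -/
def Gf (t : K) (a b : ℕ) : ℕ → ℕ → ℤ → K
  | 0, l, μ => if l = 0 ∧ 0 ≤ μ then 1 else 0
  | e + 1, l, μ => ∑ᶠ m : ℕ, if m % 2 = (min (a - 1) e + min (b - 1) e) % 2 then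
      t ^ (((l : ℤ) - m) ^ 2 - 2 * ind (a = e + 1) * m) * gaussHalf t (μ + l + m) l
        * Gf t a b e m (l - m + ind (a = e + 1) + ind (b = e + 1)) else 0

lemma finsum_nat_of_HS {F : ℕ → K} {F' : ℤ → K} {S : K} (m0 : ℤ)
    (h : HS F' S) (h1 : ∀ n : ℕ, ∀ k, (n : ℤ) = m0 - 2 * k → F n = F' k)
    (h2 : ∀ n : ℕ, ((n : ℤ) - m0) % 2 ≠ 0 → F n = 0)
    (h3 : ∀ k, m0 - 2 * k < 0 → F' k = 0) : ∑ᶠ n, F n = S := by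
  rw [← h.2]
  have e1 : ∑ᶠ n, F n = ∑ᶠ n ∈ Function.support F, F n := (finsum_mem_support F).symm
  have e2 : ∑ᶠ n, F' n = ∑ᶠ n ∈ Function.support F', F' n := (finsum_mem_support F').symm
  rw [e1, e2]
  refine finsum_mem_eq_of_bijOn (fun n => (m0 - n) / 2) ⟨?_, ?_, ?_⟩ ?_
  · intro n hn
    have hp : ((n : ℤ) - m0) % 2 = 0 := by
      by_contra hc; exact hn (h2 n hc)
    have := h1 n ((m0 - n) / 2) (by omega)
    simp only [Function.mem_support] at hn ⊢
    rwa [← this]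
  · intro n hn n' hn' hh
    have hp : ((n : ℤ) - m0) % 2 = 0 := by
      by_contra hc; exact hn (h2 n hc)
    have hp' : ((n' : ℤ) - m0) % 2 = 0 := by
      by_contra hc; exact hn' (h2 n' hc)
    simp only at hh
    omega
  · intro k hk
    have hk0 : ¬ m0 - 2 * k < 0 := fun hc => hk (h3 k hc)
    refine ⟨(m0 - 2 * k).toNat, ?_, ?_⟩
    · have := h1 (m0 - 2 * k).toNat k (by omega)
      simp only [Function.mem_support] at hk ⊢
      rwa [this]
    · simp only; omega
  · intro n hn
    have hp : ((n : ℤ) - m0) % 2 = 0 := by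
      by_contra hc; exact hn (h2 n hc)
    exact h1 n _ (by omega)

/-- conversion of the recursion into a sum over `k` -/
lemma Gf_step (a b e : ℕ) {l : ℕ} {μ M m0 : ℤ} {X : ℤ → K} {S : K}
    (hpar : m0 % 2 = ((min (a - 1) e + min (b - 1) e : ℕ) : ℤ) % 2)
    (hM : μ = 2 * M + l - m0)
    (hX : ∀ n : ℕ, ∀ k, (n : ℤ) = m0 - 2 * k →
      Gf t a b e n (l - m0 + 2 * k + ind (a = e + 1) + ind (b = e + 1)) = X k)
    (hX' : ∀ k, m0 - 2 * k < 0 → X k = 0)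
    (hS : HS (fun k => t ^ ((l - m0 + 2 * k) ^ 2 - 2 * ind (a = e + 1) * (m0 - 2 * k)) *
      hh t l (M - k) * X k) S) :
    Gf t a b (e + 1) l μ = S := by
  rw [Gf]
  refine finsum_nat_of_HS m0 hS ?_ ?_ ?_
  · intro n k hn
    rw [if_pos (by omega), ← hX n k hn, show (n : ℤ) = m0 - 2 * k from hn]
    unfold gaussHalf hh
    rw [if_pos (by omega), show (μ + l + (m0 - 2 * k)) / 2 = l + (M - k) by omega]
    ring_nf
  · intro n hn
    rw [if_neg (by omega)]
  · intro k hk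
    rw [hX' k hk, mul_zero]
end

section
variable {t : K}

/-- the bosonic form claim at stage `e` (so `P = e + 2`) -/
def Claim (t : K) (a b e : ℕ) : Prop :=
  (a ≤ e → b ≤ e → ∀ (c M : ℤ) (n : ℕ), (n : ℤ) = a + b + 2 * c →
    Gf t a b e n (2 * M) = t ^ ((b : ℤ) - a) * Phi t (e + 2) a b c M 0) ∧
  (a ≤ e → e < b → ∀ (c M : ℤ) (n : ℕ), (n : ℤ) = a + (e + 1) + 2 * c →
    Gf t a b e n (2 * M + 1) = t ^ ((e : ℤ) + 1 - a) * Phi t (e + 2) a (e + 1) c M 1) ∧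
  (e < a → b ≤ e → ∀ (c M : ℤ) (n : ℕ), (n : ℤ) = 1 + (e + 2 - b) + 2 * c →
    Gf t a b e n (2 * M + 1) = t ^ ((e : ℤ) + 1 - b) * Phi t (e + 2) 1 (e + 2 - b) c M 1) ∧
  (e < a → e < b → ∀ (c M : ℤ) (n : ℕ), (n : ℤ) = 2 + 2 * c →
    Gf t a b e n (2 * M) = Phi t (e + 2) 1 1 c M 0)

lemma ind_pos {p : Prop} (h : p) : ind p = 1 := if_pos h
lemma ind_neg {p : Prop} (h : ¬ p) : ind p = 0 := if_neg h

theorem claim (H : Good t) (a b : ℕ) (ha : 1 ≤ a) (hb : 1 ≤ b) (e : ℕ) : Claim t a b e := by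
  induction e with
  | zero =>
    refine ⟨by omega, by omega, by omega, ?_⟩
    intro _ _ c M n hn
    rw [Gf]
    simp only [Nat.cast_zero, zero_add]
    by_cases hc : 0 ≤ c
    · rw [base_zero H hc, if_neg (by omega)]
    · obtain rfl : c = -1 := by omega
      by_cases hM : 0 ≤ M
      · rw [base_one H hM, if_pos (by omega)]
      · rw [Phi_neg _ _ _ _ _ (by omega), if_neg (by omega)]
  | succ e ih =>
    obtain ⟨hW, hV, hU, hZ⟩ := ih
    refine ⟨?_, ?_, ?_, ?_⟩
    · intro hae hbe c M l hl
      by_cases h1 : a ≤ e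
      · have ia : ind (a = e + 1) = 0 := ind_neg (by omega)
        by_cases h2 : b ≤ e
        · have ib : ind (b = e + 1) = 0 := ind_neg (by omega)
          refine Gf_step a b e (m0 := l) (M := M)
            (X := fun k => t ^ ((b : ℤ) - a) * Phi t (e + 2) a b (c - k) k 0)
            (by omega) (by ring) ?_ ?_ ?_
          · intro n k hn
            rw [← hW h1 h2 (c - k) k n (by omega), ia, ib]; ring_nf
          · intro k hk
            rw [Phi_lneg _ _ _ _ (by omega), mul_zero]
          · refine ((step_plain H (P := e + 2) (a := a) (b := b) (c := c) (M := M) (δ := 0) (by omega)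
              (by omega) (by omega) (by omega) (by omega) (by omega) (by omega)).mul (t ^ ((b : ℤ) - a))).congr2
              (fun k => ?_) ?_
            · rw [ia, hl]; ring_nf
            · push_cast; ring_nf
        · have ib : ind (b = e + 1) = 1 := ind_pos (by omega)
          have hbe' : (b : ℤ) = e + 1 := by omega
          refine Gf_step a b e (m0 := l) (M := M)
            (X := fun k => t ^ ((e : ℤ) + 1 - a) * Phi t (e + 2) a (e + 1) (c - k) k 1)
            (by omega) (by ring) ?_ ?_ ?_
          · intro n k hn
            rw [← hV h1 (by omega) (c - k) k n (by omega), ia, ib]; ring_nf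
          · intro k hk
            rw [Phi_lneg _ _ _ _ (by omega), mul_zero]
          · refine ((step_b1 H (P := e + 2) (a := a) (c := c) (M := M) (by omega)
              (by omega) (by omega) (by omega)).mul (t ^ ((b : ℤ) - a))).congr2
              (fun k => ?_) ?_
            · rw [ia, hl, hbe']; ring_nf
            · push_cast; rw [hbe']; ring_nf
      · have hae' : (a : ℤ) = e + 1 := by omega
        have ia : ind (a = e + 1) = 1 := ind_pos (by omega)
        by_cases h2 : b ≤ e
        · have ib : ind (b = e + 1) = 0 := ind_neg (by omega)
          -- U to W: the variable `c` of the source is `c + b` (in terms of the target)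
          refine Gf_step a b e (m0 := l) (M := M)
            (X := fun k => t ^ ((e : ℤ) + 1 - b) * Phi t (e + 2) 1 (e + 2 - b) ((c + b - 1) - k) k 1)
            (by omega) (by ring) ?_ ?_ ?_
          · intro n k hn
            rw [← hU (by omega) h2 ((c + b - 1) - k) k n (by omega), ia, ib]; ring_nf
          · intro k hk
            rw [Phi_lneg _ _ _ _ (by omega), mul_zero]
          · refine ((step_a H (P := e + 2) (b := e + 2 - b) (c := c + b - 1) (M := M) (δ := 1) (by omega)
              (by omega) (by omega) (by omega) (by omega) (by omega)).mul
              (t ^ ((e : ℤ) + 1 - b - 2 * l))).congr2 (fun k => ?_) ?_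
            · rw [ia]
              rw [show (l : ℤ) = e + 2 - b + 2 * (c + b - 1) + 1 by omega]
              generalize Phi t _ _ _ _ _ _ = Y
              generalize hh t _ _ = Z
              have : ∀ p q r s : ℤ, p + q = r + s → t ^ p * Z * (t ^ q * Y) = t ^ r * (t ^ s * Z * Y) := by
                intro p q r s h
                have : t ^ p * t ^ q = t ^ r * t ^ s := by
                  rw [← zpow_add₀ H.1, ← zpow_add₀ H.1, h]
                linear_combination Z * Y * this
              apply this
              ring
            · rw [← mul_assoc, ← zpow_add₀ H.1]
              push_cast
              rw [hl, hae']
              ring_nf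
        · have hbe' : (b : ℤ) = e + 1 := by omega
          have ib : ind (b = e + 1) = 1 := ind_pos (by omega)
          refine Gf_step a b e (m0 := l) (M := M)
            (X := fun k => Phi t (e + 2) 1 1 ((c + e) - k) (k + 1) 0)
            (by omega) (by ring) ?_ ?_ ?_
          · intro n k hn
            rw [← hZ (by omega) (by omega) ((c + e) - k) (k + 1) n (by omega), ia, ib]; ring_nf
          · intro k hk
            rw [Phi_lneg _ _ _ _ (by omega)]
          · refine ((step_ab H (P := e + 2) (c := c + e) (M := M) (by omega) (by omega)).mul
              (t ^ (- 2 * (l : ℤ)))).congr2 (fun k => ?_) ?_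
            · rw [ia]
              rw [show (l : ℤ) = 2 + 2 * (c + e) by omega]
              generalize Phi t _ _ _ _ _ _ = Y
              generalize hh t _ _ = Z
              have : ∀ p r s : ℤ, p = r + s → t ^ p * Z * Y = t ^ r * (t ^ s * Z * Y) := by
                intro p r s h
                rw [h, zpow_add₀ H.1]; ring
              apply this
              ring
            · rw [← mul_assoc, ← zpow_add₀ H.1]
              push_cast
              rw [hl, hae', hbe']
              ring_nf
    · intro hae hbe c M l hl
      by_cases h1 : a ≤ e
      · have ia : ind (a = e + 1) = 0 := ind_neg (by omega)
        have ib : ind (b = e + 1) = 0 := ind_neg (by omega)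
        push_cast at hl
        refine Gf_step a b e (m0 := (l : ℤ) - 1) (M := M)
          (X := fun k => t ^ ((e : ℤ) + 1 - a) * Phi t (e + 2) a (e + 1) (c - k) k 1)
          (by omega) (by ring) ?_ ?_ ?_
        · intro n k hn
          rw [← hV h1 (by omega) (c - k) k n (by omega), ia, ib]; ring_nf
        · intro k hk
          rw [Phi_lneg _ _ _ _ (by omega), mul_zero]
        · refine ((step_plain H (P := e + 2) (a := a) (b := e + 1) (c := c) (M := M) (δ := 1) (by omega)
            (by omega) (by omega) (by omega) (by omega) (by omega) (by omega)).mul (t ^ ((e : ℤ) + 1 - a + 1))).congr2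
            (fun k => ?_) ?_
          · rw [ia]
            rw [show (l : ℤ) = a + (e + 1) + 1 + 2 * c by omega]
            generalize Phi t _ _ _ _ _ _ = Y
            generalize hh t _ _ = Z
            have : ∀ p q r s : ℤ, p + q = r + s → t ^ p * Z * (t ^ q * Y) = t ^ r * (t ^ s * Z * Y) := by
              intro p q r s h
              have : t ^ p * t ^ q = t ^ r * t ^ s := by
                rw [← zpow_add₀ H.1, ← zpow_add₀ H.1, h]
              linear_combination Z * Y * this
            apply this
            ring
          · push_cast; ring_nf
      · have hae' : (a : ℤ) = e + 1 := by omega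
        have ia : ind (a = e + 1) = 1 := ind_pos (by omega)
        have ib : ind (b = e + 1) = 0 := ind_neg (by omega)
        push_cast at hl
        refine Gf_step a b e (m0 := (l : ℤ) + 1) (M := M + 1)
          (X := fun k => Phi t (e + 2) 1 1 ((c + e + 1) - k) k 0)
          (by omega) (by ring) ?_ ?_ ?_
        · intro n k hn
          rw [← hZ (by omega) (by omega) ((c + e + 1) - k) k n (by omega), ia, ib]; ring_nf
        · intro k hk
          rw [Phi_lneg _ _ _ _ (by omega)]
        · refine ((step_a H (P := e + 2) (b := 1) (c := c + e + 1) (M := M + 1) (δ := 0) (by omega)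
            (by omega) (by omega) (by omega) (by omega) (by omega)).mul
            (t ^ (1 - 2 * ((l : ℤ) + 1)))).congr2 (fun k => ?_) ?_
          · rw [ia]
            rw [show (l : ℤ) = 1 + 2 * (c + e + 1) + 0 by omega]
            generalize Phi t _ _ _ _ _ _ = Y
            generalize hh t _ _ = Z
            have : ∀ p r s : ℤ, p = r + s → t ^ p * Z * Y = t ^ r * (t ^ s * Z * Y) := by
              intro p r s h
              rw [h, zpow_add₀ H.1]; ring
            apply this
            ring
          · rw [← mul_assoc, ← zpow_add₀ H.1]
            push_cast
            rw [hl, hae']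
            ring_nf
    · intro hae hbe c M l hl
      push_cast at hl
      by_cases h2 : b ≤ e
      · have ia : ind (a = e + 1) = 0 := ind_neg (by omega)
        have ib : ind (b = e + 1) = 0 := ind_neg (by omega)
        refine Gf_step a b e (m0 := (l : ℤ) - 1) (M := M)
          (X := fun k => t ^ ((e : ℤ) + 1 - b) * Phi t (e + 2) 1 (e + 2 - b) (c - k) k 1)
          (by omega) (by ring) ?_ ?_ ?_
        · intro n k hn
          rw [← hU (by omega) h2 (c - k) k n (by omega), ia, ib]; ring_nf
        · intro k hk
          rw [Phi_lneg _ _ _ _ (by omega), mul_zero]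
        · refine ((step_plain H (P := e + 2) (a := 1) (b := e + 2 - b) (c := c) (M := M) (δ := 1) (by omega)
            (by omega) (by omega) (by omega) (by omega) (by omega) (by omega)).mul (t ^ ((e : ℤ) + 1 - b + 1))).congr2
            (fun k => ?_) ?_
          · rw [ia]
            rw [show (l : ℤ) = 1 + (e + 2 - b) + 1 + 2 * c by omega]
            generalize Phi t _ _ _ _ _ _ = Y
            generalize hh t _ _ = Z
            have : ∀ p q r s : ℤ, p + q = r + s → t ^ p * Z * (t ^ q * Y) = t ^ r * (t ^ s * Z * Y) := by
              intro p q r s h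
              have : t ^ p * t ^ q = t ^ r * t ^ s := by
                rw [← zpow_add₀ H.1, ← zpow_add₀ H.1, h]
              linear_combination Z * Y * this
            apply this
            ring
          · push_cast; ring_nf
      · have ia : ind (a = e + 1) = 0 := ind_neg (by omega)
        have ib : ind (b = e + 1) = 1 := ind_pos (by omega)
        have hbe' : (b : ℤ) = e + 1 := by omega
        refine Gf_step a b e (m0 := (l : ℤ) - 1) (M := M)
          (X := fun k => Phi t (e + 2) 1 1 (c - k) (k + 1) 0)
          (by omega) (by ring) ?_ ?_ ?_
        · intro n k hn
          rw [← hZ (by omega) (by omega) (c - k) (k + 1) n (by omega), ia, ib]; ring_nf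
        · intro k hk
          rw [Phi_lneg _ _ _ _ (by omega)]
        · refine ((step_b2 H (P := e + 2) (c := c) (M := M) (by omega) (by omega)).mul
            (t ^ (1 : ℤ))).congr2 (fun k => ?_) ?_
          · rw [ia]
            rw [show (l : ℤ) = 3 + 2 * c by omega]
            generalize Phi t _ _ _ _ _ _ = Y
            generalize hh t _ _ = Z
            have : ∀ p r s : ℤ, p = r + s → t ^ p * Z * Y = t ^ r * (t ^ s * Z * Y) := by
              intro p r s h
              rw [h, zpow_add₀ H.1]; ring
            apply this
            ring
          · push_cast
            rw [hbe']
            ring_nf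
    · intro hae hbe c M l hl
      have ia : ind (a = e + 1) = 0 := ind_neg (by omega)
      have ib : ind (b = e + 1) = 0 := ind_neg (by omega)
      refine Gf_step a b e (m0 := l) (M := M)
        (X := fun k => Phi t (e + 2) 1 1 (c - k) k 0)
        (by omega) (by ring) ?_ ?_ ?_
      · intro n k hn
        rw [← hZ (by omega) (by omega) (c - k) k n (by omega), ia, ib]; ring_nf
      · intro k hk
        rw [Phi_lneg _ _ _ _ (by omega)]
      · refine (step_plain H (P := e + 2) (a := 1) (b := 1) (c := c) (M := M) (δ := 0) (by omega)
          (by omega) (by omega) (by omega) (by omega) (by omega) (by omega)).congr2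
          (fun k => ?_) ?_
        · rw [ia, hl]; ring_nf
        · push_cast; ring_nf
end

section
variable {t : K}

lemma inc_succ (d : ℕ) (i k : Fin d) : inc (d + 1) i.succ k.succ = inc d i k := by
  simp [inc]

lemma inc_zero_zero (d : ℕ) : inc (d + 1) 0 0 = 0 := by simp [inc]

lemma inc_zero_succ (d : ℕ) (k : Fin (d + 1)) : inc (d + 2) 0 k.succ = if k = 0 then 1 else 0 := by
  by_cases h : k = 0
  · subst h; simp [inc]
  · have h' : (k : ℕ) ≠ 0 := fun hk => h (Fin.ext hk)
    simp [inc, h, h']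

lemma inc_succ_zero (d : ℕ) (k : Fin (d + 1)) : inc (d + 2) k.succ 0 = if k = 0 then 1 else 0 := by
  by_cases h : k = 0
  · subst h; simp [inc]
  · have h' : (k : ℕ) ≠ 0 := fun hk => h (Fin.ext hk)
    simp [inc, h, h']

lemma uv_succ (d : ℕ) (s : ℤ) (i : Fin d) : uv (d + 1) (s + 1) i.succ = uv d s i := by
  simp [uv]

lemma uv_zero (d : ℕ) (s : ℤ) : uv (d + 1) s 0 = ind (s = 1) := by
  simp [uv, ind, eq_comm]

lemma mAt_cons (d : ℕ) (s : ℤ) (l : ℕ) (m : Fin d → ℕ) :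
    mAt (d + 1) (Fin.cons l m) (s + 1) = ind (s = 0) * l + mAt d m s := by
  unfold mAt
  rw [Fin.sum_univ_succ, uv_zero]
  simp [uv_succ]

lemma quadC_cons (d : ℕ) (l : ℕ) (m : Fin (d + 1) → ℕ) :
    quadC (d + 2) (Fin.cons l m) = 2 * (l : ℤ) ^ 2 - 2 * l * m 0 + quadC (d + 1) m := by
  unfold quadC
  rw [Fin.sum_univ_succ, Fin.sum_univ_succ]
  simp only [Fin.sum_univ_succ (n := d + 1), Finset.sum_add_distrib, Fin.cons_zero, Fin.cons_succ, cartan]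
  have h1 : ∑ k : Fin (d + 1), (l : ℤ) * ((if (0 : Fin (d + 2)) = k.succ then 2 else 0)
      - inc (d + 1 + 1) 0 k.succ) * (m k : ℤ) = - l * m 0 := by
    have : ∀ k : Fin (d + 1), (l : ℤ) * ((if (0 : Fin (d + 2)) = k.succ then 2 else 0)
      - inc (d + 1 + 1) 0 k.succ) * (m k : ℤ) = if k = 0 then - (l : ℤ) * m 0 else 0 := by
      intro k
      rw [inc_zero_succ, if_neg (Fin.succ_ne_zero k).symm]
      split_ifs with h
      · subst h; ring
      · ring
    simp only [this]; simp
  have h2 : ∑ k : Fin (d + 1), (m k : ℤ) * ((if k.succ = (0 : Fin (d + 2)) then 2 else 0)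
      - inc (d + 1 + 1) k.succ 0) * (l : ℤ) = - l * m 0 := by
    have : ∀ k : Fin (d + 1), (m k : ℤ) * ((if k.succ = (0 : Fin (d + 2)) then 2 else 0)
      - inc (d + 1 + 1) k.succ 0) * (l : ℤ) = if k = 0 then - (l : ℤ) * m 0 else 0 := by
      intro k
      rw [inc_succ_zero, if_neg (Fin.succ_ne_zero k)]
      split_ifs with h
      · subst h; ring
      · ring
    simp only [this]; simp
  rw [h1, h2, inc_zero_zero]
  simp only [Fin.succ_inj, inc_succ]
  simp only [if_true]
  ring

lemma quadC_one (m : Fin 1 → ℕ) : quadC 1 m = 2 * (m 0 : ℤ) ^ 2 := by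
  simp [quadC, cartan, inc]; ring

/-- top entry, at the level of `d` -/
lemma topE_cons_zero (d a b L l : ℕ) (m : Fin (d + 1) → ℕ) :
    topE (d + 5) a b L (Fin.cons l m : Fin (d + 2) → ℕ) (0 : Fin (d + 2))
      = L + m 0 + ind (a = d + 3) + ind (b = d + 3) := by
  unfold topE
  show (∑ k : Fin (d + 2), inc (d + 2) 0 k * ((Fin.cons l m : Fin (d + 2) → ℕ) k : ℤ))
    + (L : ℤ) * uv (d + 2) 1 0 + uv (d + 2) (((d + 5 : ℕ) : ℤ) - a - 1) 0
    + uv (d + 2) (((d + 5 : ℕ) : ℤ) - b - 1) 0 = _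
  rw [Fin.sum_univ_succ, uv_zero, uv_zero, uv_zero, inc_zero_zero]
  simp only [inc_zero_succ, Fin.cons_succ]
  have h1 : (((d + 5 : ℕ) : ℤ) - a - 1 = 1) = (a = d + 3) := by
    apply propext; omega
  have h2 : (((d + 5 : ℕ) : ℤ) - b - 1 = 1) = (b = d + 3) := by
    apply propext; omega
  rw [h1, h2]
  simp [ind]
  ring

lemma topE_cons_succ (d a b L l : ℕ) (m : Fin (d + 1) → ℕ) (i : Fin (d + 1)) :
    topE (d + 5) a b L (Fin.cons l m : Fin (d + 2) → ℕ) (i.succ : Fin (d + 2))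
      = topE (d + 4) a b l m i := by
  unfold topE
  show (∑ k : Fin (d + 2), inc (d + 2) i.succ k * ((Fin.cons l m : Fin (d + 2) → ℕ) k : ℤ))
    + (L : ℤ) * uv (d + 2) 1 i.succ + uv (d + 2) (((d + 5 : ℕ) : ℤ) - a - 1) i.succ
    + uv (d + 2) (((d + 5 : ℕ) : ℤ) - b - 1) i.succ
    = (∑ k : Fin (d + 1), inc (d + 1) i k * (m k : ℤ))
    + (l : ℤ) * uv (d + 1) 1 i + uv (d + 1) (((d + 4 : ℕ) : ℤ) - a - 1) i
    + uv (d + 1) (((d + 4 : ℕ) : ℤ) - b - 1) i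
  rw [show (((d + 5 : ℕ) : ℤ) - a - 1) = (((d + 4 : ℕ) : ℤ) - a - 1) + 1 by push_cast; ring,
    show (((d + 5 : ℕ) : ℤ) - b - 1) = (((d + 4 : ℕ) : ℤ) - b - 1) + 1 by push_cast; ring,
    uv_succ, uv_succ, Fin.sum_univ_succ]
  simp only [inc_succ, inc_succ_zero, Fin.cons_succ, Fin.cons_zero]
  have h1 : uv (d + 2) 1 i.succ = 0 := by simp [uv]; omega
  have h2 : uv (d + 1) 1 i = if i = 0 then 1 else 0 := by
    unfold uv
    by_cases hi : i = 0
    · subst hi; simp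
    · have h' : (i : ℕ) ≠ 0 := fun hk => hi (Fin.ext hk)
      rw [if_neg (by omega), if_neg hi]
  rw [h1, h2]
  ring

lemma fermTerm_cons (H : Good t) (d a b L l : ℕ) (m : Fin (d + 1) → ℕ) :
    fermTerm (d + 5) a b L t (Fin.cons l m : Fin (d + 2) → ℕ)
      = t ^ (2 * (l : ℤ) ^ 2 - 2 * l * m 0 - 2 * ind (a = d + 3) * l)
        * gaussHalf t (L + m 0 + ind (a = d + 3) + ind (b = d + 3)) l
        * fermTerm (d + 4) a b l t m := by
  unfold fermTerm
  show t ^ (quadC (d + 2) (Fin.cons l m : Fin (d + 2) → ℕ)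
      - 2 * mAt (d + 2) (Fin.cons l m : Fin (d + 2) → ℕ) (((d + 5 : ℕ) : ℤ) - a - 1)) *
    ∏ i : Fin (d + 2), gaussHalf t (topE (d + 5) a b L (Fin.cons l m : Fin (d + 2) → ℕ) i)
      ((Fin.cons l m : Fin (d + 2) → ℕ) i)
    = _ * _ * (t ^ (quadC (d + 1) m - 2 * mAt (d + 1) m (((d + 4 : ℕ) : ℤ) - a - 1)) *
    ∏ i : Fin (d + 1), gaussHalf t (topE (d + 4) a b l m i) (m i))
  rw [Fin.prod_univ_succ, topE_cons_zero, quadC_cons,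
    show (((d + 5 : ℕ) : ℤ) - a - 1) = (((d + 4 : ℕ) : ℤ) - a - 1) + 1 by push_cast; ring, mAt_cons]
  have h1 : (((d + 4 : ℕ) : ℤ) - a - 1 = 0) = (a = d + 3) := by
    apply propext; omega
  rw [h1]
  simp only [topE_cons_succ, Fin.cons_zero, Fin.cons_succ]
  rw [show 2 * (l : ℤ) ^ 2 - 2 * l * m 0 + quadC (d + 1) m
    - 2 * (ind (a = d + 3) * l + mAt (d + 1) m (((d + 4 : ℕ) : ℤ) - a - 1))
    = (2 * (l : ℤ) ^ 2 - 2 * l * m 0 - 2 * ind (a = d + 3) * l) +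
      (quadC (d + 1) m - 2 * mAt (d + 1) m (((d + 4 : ℕ) : ℤ) - a - 1)) by ring, zpow_add₀ H.1]
  ring

lemma fermTerm_base (a b L : ℕ) (m : Fin 1 → ℕ) :
    fermTerm 4 a b L t m = t ^ (2 * (m 0 : ℤ) ^ 2 - 2 * ind (a = 2) * m 0)
      * gaussHalf t (L + ind (a = 2) + ind (b = 2)) (m 0) := by
  unfold fermTerm
  show t ^ (quadC 1 m - 2 * mAt 1 m (((4 : ℕ) : ℤ) - a - 1)) *
    ∏ i : Fin 1, gaussHalf t (topE 4 a b L m i) (m i) = _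
  have h1 : ∀ a : ℕ, ((4 : ℤ) - a - 1 = 1) = (a = 2) := by
    intro a; apply propext; omega
  have h1' : ∀ a : ℕ, (1 = (4 : ℤ) - a - 1) = (a = 2) := by
    intro a; apply propext; omega
  simp only [Fin.prod_univ_succ, Fin.prod_univ_zero, mul_one]
  rw [quadC_one]
  have e1 : mAt 1 m (((4 : ℕ) : ℤ) - a - 1) = ind (a = 2) * m 0 := by
    simp [mAt, uv, ind, h1']
  have e2 : topE 4 a b L m (0 : Fin 1) = L + ind (a = 2) + ind (b = 2) := by
    unfold topE
    show (∑ k : Fin 1, inc 1 0 k * (m k : ℤ)) + (L : ℤ) * uv 1 1 0 + uv 1 (((4 : ℕ) : ℤ) - a - 1) 0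
      + uv 1 (((4 : ℕ) : ℤ) - b - 1) 0 = _
    simp [uv, ind, h1', inc]
    split_ifs <;> rfl
  rw [e1]
  refine congrArg₂ _ (by ring_nf) ?_
  exact congrArg₂ _ e2 rfl

lemma parity_cons (d a b l : ℕ) (m : Fin (d + 1) → ℕ) :
    parity (d + 5) a b (Fin.cons l m : Fin (d + 2) → ℕ) ↔
      (l % 2 = (min (a - 1) (d + 2) + min (b - 1) (d + 2)) % 2 ∧ parity (d + 4) a b m) := by
  unfold parity
  show (∀ i : Fin (d + 2), (Fin.cons l m : Fin (d + 2) → ℕ) i % 2 = Qab (d + 5) a b i % 2) ↔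
    (_ ∧ ∀ i : Fin (d + 1), m i % 2 = Qab (d + 4) a b i % 2)
  rw [Fin.forall_fin_succ]
  simp only [Fin.cons_zero, Fin.cons_succ]
  have h0 : Qab (d + 5) a b (0 : Fin (d + 2)) = min (a - 1) (d + 2) + min (b - 1) (d + 2) := by
    simp [Qab]
  have h1 : ∀ i : Fin (d + 1), Qab (d + 5) a b (i.succ : Fin (d + 2)) = Qab (d + 4) a b i := by
    intro i
    simp only [Qab, Fin.val_succ]
    congr 2 <;> omega
  rw [h0]
  simp only [h1]

lemma parity_base (a b : ℕ) (m : Fin 1 → ℕ) :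
    parity 4 a b m ↔ m 0 % 2 = (min (a - 1) 1 + min (b - 1) 1) % 2 := by
  unfold parity
  show (∀ i : Fin 1, m i % 2 = Qab 4 a b i % 2) ↔ _
  rw [Fin.forall_fin_one]
  have h0 : Qab 4 a b (0 : Fin 1) = min (a - 1) 1 + min (b - 1) 1 := by
    simp [Qab]
  rw [h0]
end

section
variable {t : K}

lemma gaussHalf_ne {N m : ℤ} (h : gaussHalf t N m ≠ 0) : 0 ≤ m ∧ 2 * m ≤ N := by
  unfold gaussHalf gauss at h
  split_ifs at h with h1 h2
  · omega
  · exact absurd rfl h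
  · exact absurd rfl h

lemma ne_of_eq' {x y : K} (e : x = y) (h : x ≠ 0) : y ≠ 0 := e ▸ h

lemma exists_ne_of_finsum {f : ℕ → K} (h : ∑ᶠ n, f n ≠ 0) : ∃ n, f n ≠ 0 := by
  by_contra! hc
  exact h (finsum_eq_zero_of_forall_eq_zero hc)

lemma ind_le (p : Prop) : ind p ≤ 1 := by unfold ind; split_ifs <;> omega
lemma ind_nonneg (p : Prop) : 0 ≤ ind p := by unfold ind; split_ifs <;> omega

lemma fermBound (H : Good t) (a b d : ℕ) : ∀ (L : ℕ) (m : Fin (d + 1) → ℕ),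
    fermTerm (d + 4) a b L t m ≠ 0 → (m 0 : ℤ) ≤ (d + 1) * ((L : ℤ) - m 0 + 2 + 2 * d) := by
  induction d with
  | zero =>
    intro L m h
    replace h := ne_of_eq' (fermTerm_base a b L m) h
    have := gaussHalf_ne (right_ne_zero_of_mul h)
    have := ind_le (a = 2)
    have := ind_le (b = 2)
    push_cast
    linarith
  | succ d ih =>
    intro L m h
    obtain ⟨l, m', rfl⟩ : ∃ l m', m = Fin.cons l m' := ⟨_, _, (Fin.cons_self_tail m).symm⟩
    replace h := ne_of_eq' (fermTerm_cons H d a b L l m') h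
    have h1 := gaussHalf_ne (right_ne_zero_of_mul (left_ne_zero_of_mul h))
    have h2 := ih l m' (right_ne_zero_of_mul h)
    have := ind_le (a = d + 3)
    have := ind_le (b = d + 3)
    rw [Fin.cons_zero]
    push_cast
    have hd : (0 : ℤ) ≤ d := by positivity
    nlinarith

lemma ferm_finite (H : Good t) (a b d : ℕ) : ∀ (L l : ℕ),
    {rest : Fin d → ℕ | fermTerm (d + 4) a b L t (Fin.cons l rest : Fin (d + 1) → ℕ) ≠ 0}.Finite := by
  induction d with
  | zero => intro L l; exact Set.toFinite _
  | succ d ih =>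
    intro L l
    refine Set.Finite.subset (s := ⋃ m' ∈ Set.Iic ((d + 1) * (l + 2 + 2 * d)),
      Set.image (fun rest : Fin d → ℕ => (Fin.cons m' rest : Fin (d + 1) → ℕ))
        {rest : Fin d → ℕ | fermTerm (d + 4) a b l t (Fin.cons m' rest : Fin (d + 1) → ℕ) ≠ 0}) ?_ ?_
    · exact (Set.finite_Iic _).biUnion fun m' _ => (ih l m').image _
    · intro rest h
      simp only [Set.mem_ofPred_eq] at h
      replace h := ne_of_eq' (fermTerm_cons H d a b L l rest) h
      have h1 := right_ne_zero_of_mul h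
      have h2 := fermBound H a b d l rest h1
      simp only [Set.mem_iUnion]
      refine ⟨rest 0, ?_, Fin.tail rest, ?_, Fin.cons_self_tail rest⟩
      · rw [Set.mem_Iic]
        have hd : (0 : ℤ) ≤ d := by positivity
        zify
        nlinarith [mul_nonneg hd (Int.natCast_nonneg (rest 0))]
      · rw [Set.mem_ofPred_eq, Fin.cons_self_tail]; exact h1

/-- parity of the first entry at stage `e` -/
def par (a b e l : ℕ) : Prop := l % 2 = (min (a - 1) e + min (b - 1) e) % 2

def AT (t : K) (a b d L l : ℕ) : K :=
  ∑ᶠ rest : Fin d → ℕ, if parity (d + 4) a b (Fin.cons l rest : Fin (d + 1) → ℕ) then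
    fermTerm (d + 4) a b L t (Fin.cons l rest : Fin (d + 1) → ℕ) else 0

lemma finsum_cons {d : ℕ} (f : (Fin (d + 1) → ℕ) → K) (hf : (Function.support f).Finite) :
    ∑ᶠ rest, f rest = ∑ᶠ m' : ℕ, ∑ᶠ rest : Fin d → ℕ, f (Fin.cons m' rest) := by
  rw [← finsum_comp_equiv (Fin.consEquiv (fun _ : Fin (d + 1) => ℕ))]
  rw [finsum_curry]
  · rfl
  · exact hf.preimage ((Fin.consEquiv (fun _ : Fin (d + 1) => ℕ)).injective.injOn)

/-- the summand without the first Gaussian polynomial -/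
def sT (t : K) (a b d : ℕ) (m : Fin (d + 1) → ℕ) : K :=
  if parity (d + 4) a b m then
    t ^ (quadC (d + 1) m - 2 * mAt (d + 1) m (((d + 4 : ℕ) : ℤ) - a - 1)) *
    ∏ i : Fin (d + 1), (if 1 ≤ (i : ℕ) then gaussHalf t (topC (d + 4) a b 0 m i) (m i) else 1)
  else 0

def Ssum (t : K) (a b d l : ℕ) : K := ∑ᶠ rest : Fin d → ℕ, sT t a b d (Fin.cons l rest)

lemma sT_cons (H : Good t) (d a b l : ℕ) (m : Fin (d + 1) → ℕ) :
    sT t a b (d + 1) (Fin.cons l m)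
      = if par a b (d + 2) l then t ^ (2 * (l : ℤ) ^ 2 - 2 * l * m 0 - 2 * ind (a = d + 3) * l)
        * (if parity (d + 4) a b m then fermTerm (d + 4) a b l t m else 0) else 0 := by
  unfold sT
  have hp := parity_cons d a b l m
  show (if parity (d + 5) a b (Fin.cons l m : Fin (d + 2) → ℕ) then
    t ^ (quadC (d + 2) (Fin.cons l m : Fin (d + 2) → ℕ)
      - 2 * mAt (d + 2) (Fin.cons l m : Fin (d + 2) → ℕ) (((d + 5 : ℕ) : ℤ) - a - 1)) *
    ∏ i : Fin (d + 2), (if 1 ≤ (i : ℕ) then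
      gaussHalf t (topC (d + 5) a b 0 (Fin.cons l m : Fin (d + 2) → ℕ) i)
        ((Fin.cons l m : Fin (d + 2) → ℕ) i) else 1)
    else 0) = _
  by_cases h1 : par a b (d + 2) l
  swap
  · rw [if_neg h1, if_neg]
    intro h; exact h1 (hp.1 h).1
  by_cases h2 : parity (d + 4) a b m
  swap
  · rw [if_pos h1, if_neg h2, if_neg, mul_zero]
    intro h; exact h2 (hp.1 h).2
  rw [if_pos h1, if_pos h2, if_pos (hp.2 ⟨h1, h2⟩)]
  rw [Fin.prod_univ_succ, quadC_cons,
    show (((d + 5 : ℕ) : ℤ) - a - 1) = (((d + 4 : ℕ) : ℤ) - a - 1) + 1 by push_cast; ring, mAt_cons]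
  have h1 : (((d + 4 : ℕ) : ℤ) - a - 1 = 0) = (a = d + 3) := by
    apply propext; omega
  rw [h1]
  have h3 : ∀ i : Fin (d + 1), topC (d + 5) a b 0 (Fin.cons l m : Fin (d + 2) → ℕ) (i.succ : Fin (d + 2))
      = topE (d + 4) a b l m i := by
    intro i
    rw [← topE_cons_succ d a b 0 l m i]
    simp [topC, topE]
  simp only [h3, Fin.cons_succ]
  unfold fermTerm
  show _ = _ * (t ^ (quadC (d + 1) m - 2 * mAt (d + 1) m (((d + 4 : ℕ) : ℤ) - a - 1)) *
    ∏ i : Fin (d + 1), gaussHalf t (topE (d + 4) a b l m i) (m i))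
  rw [show 2 * (l : ℤ) ^ 2 - 2 * l * m 0 + quadC (d + 1) m
    - 2 * (ind (a = d + 3) * l + mAt (d + 1) m (((d + 4 : ℕ) : ℤ) - a - 1))
    = (2 * (l : ℤ) ^ 2 - 2 * l * m 0 - 2 * ind (a = d + 3) * l) +
      (quadC (d + 1) m - 2 * mAt (d + 1) m (((d + 4 : ℕ) : ℤ) - a - 1)) by ring, zpow_add₀ H.1]
  simp [mul_assoc]

lemma sT_base (a b : ℕ) (m : Fin 1 → ℕ) :
    sT t a b 0 m = if par a b 1 (m 0) then t ^ (2 * (m 0 : ℤ) ^ 2 - 2 * ind (a = 2) * m 0) else 0 := by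
  unfold sT
  have hp := parity_base a b m
  refine (if_congr hp rfl rfl).trans ?_
  refine if_congr Iff.rfl ?_ rfl
  have h1' : ∀ a : ℕ, (1 = (4 : ℤ) - a - 1) = (a = 2) := by
    intro a; apply propext; omega
  have e1 : mAt 1 m (((0 + 4 : ℕ) : ℤ) - a - 1) = ind (a = 2) * m 0 := by
    simp [mAt, uv, ind, h1']
  rw [show quadC (0 + 1) m = 2 * (m 0 : ℤ) ^ 2 from quadC_one m, show mAt (0 + 1) m (((0 + 4 : ℕ) : ℤ) - a - 1) = _ from e1]
  simp [mul_assoc]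

lemma AT_zero (a b L l : ℕ) : AT t a b 0 L l =
    if par a b 1 l then t ^ (2 * (l : ℤ) ^ 2 - 2 * ind (a = 2) * l)
      * gaussHalf t (L + ind (a = 2) + ind (b = 2)) l else 0 := by
  unfold AT
  rw [finsum_unique]
  have hp := parity_base a b (Fin.cons l default)
  have hf := fermTerm_base (t := t) a b L (Fin.cons l default)
  rw [Fin.cons_zero] at hp hf
  have hd : (Unique.instInhabited.default : Fin 0 → ℕ) = Pi.instInhabited.default := Subsingleton.elim _ _
  rw [hd]
  exact if_congr hp hf rfl

lemma AT_succ (H : Good t) (a b d L l : ℕ) : AT t a b (d + 1) L l =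
    if par a b (d + 2) l then ∑ᶠ m' : ℕ, t ^ (2 * (l : ℤ) ^ 2 - 2 * l * m' - 2 * ind (a = d + 3) * l)
        * gaussHalf t (L + m' + ind (a = d + 3) + ind (b = d + 3)) l * AT t a b d l m' else 0 := by
  unfold AT
  rw [finsum_cons]
  · by_cases h1 : par a b (d + 2) l
    · rw [if_pos h1]
      refine finsum_congr fun m' => ?_
      rw [mul_finsum]
      · refine finsum_congr fun rest => ?_
        have hp := parity_cons d a b l (Fin.cons m' rest)
        have hf := fermTerm_cons H d a b L l (Fin.cons m' rest)
        rw [Fin.cons_zero] at hf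
        refine (if_congr Iff.rfl hf rfl).trans ?_
        by_cases h2 : parity (d + 4) a b (Fin.cons m' rest : Fin (d + 1) → ℕ)
        · rw [if_pos h2, if_pos (hp.2 ⟨h1, h2⟩)]
        · rw [if_neg h2, if_neg (fun h => h2 (hp.1 h).2), mul_zero]
    · rw [if_neg h1]
      refine finsum_eq_zero_of_forall_eq_zero fun m' => ?_
      refine finsum_eq_zero_of_forall_eq_zero fun rest => ?_
      rw [if_neg]
      intro h
      exact h1 ((parity_cons d a b l _).1 h).1
  · refine (ferm_finite H a b (d + 1) L l).subset fun rest hr => ?_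
    rw [Function.mem_support] at hr
    split_ifs at hr with h
    · exact hr
    · exact absurd rfl hr

lemma sT_finite (H : Good t) (a b d l : ℕ) :
    {rest : Fin d → ℕ | sT t a b d (Fin.cons l rest) ≠ 0}.Finite := by
  cases d with
  | zero => exact Set.toFinite _
  | succ d =>
    refine Set.Finite.subset (s := ⋃ m' ∈ Set.Iic ((d + 1) * (l + 2 + 2 * d)),
      Set.image (fun rest : Fin d → ℕ => (Fin.cons m' rest : Fin (d + 1) → ℕ))
        {rest : Fin d → ℕ | fermTerm (d + 4) a b l t (Fin.cons m' rest : Fin (d + 1) → ℕ) ≠ 0}) ?_ ?_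
    · exact (Set.finite_Iic _).biUnion fun m' _ => (ferm_finite H a b d l m').image _
    · intro rest h
      simp only [Set.mem_ofPred_eq] at h
      rw [sT_cons H] at h
      split_ifs at h with h0 h0'
      · have h1 := right_ne_zero_of_mul h
        have h2 := fermBound H a b d l rest h1
        simp only [Set.mem_iUnion]
        refine ⟨rest 0, ?_, Fin.tail rest, ?_, Fin.cons_self_tail rest⟩
        · rw [Set.mem_Iic]
          have hd : (0 : ℤ) ≤ d := by positivity
          zify
          nlinarith [mul_nonneg hd (Int.natCast_nonneg (rest 0))]
        · rw [Set.mem_ofPred_eq, Fin.cons_self_tail]; exact h1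
      · simp at h
      · simp at h

lemma Ssum_zero (a b l : ℕ) : Ssum t a b 0 l =
    if par a b 1 l then t ^ (2 * (l : ℤ) ^ 2 - 2 * ind (a = 2) * l) else 0 := by
  unfold Ssum
  rw [finsum_unique, sT_base]; simp

lemma Ssum_succ (H : Good t) (a b d l : ℕ) : Ssum t a b (d + 1) l =
    if par a b (d + 2) l then ∑ᶠ m' : ℕ, t ^ (2 * (l : ℤ) ^ 2 - 2 * l * m' - 2 * ind (a = d + 3) * l)
       * AT t a b d l m' else 0 := by
  unfold Ssum AT
  rw [finsum_cons _ (sT_finite H a b (d + 1) l)]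
  by_cases h1 : par a b (d + 2) l
  · rw [if_pos h1]
    refine finsum_congr fun m' => ?_
    rw [mul_finsum]
    · refine finsum_congr fun rest => ?_
      rw [sT_cons H, if_pos h1, Fin.cons_zero]
  · rw [if_neg h1]
    refine finsum_eq_zero_of_forall_eq_zero fun m' => ?_
    refine finsum_eq_zero_of_forall_eq_zero fun rest => ?_
    rw [sT_cons H, if_neg h1]

lemma Gf_zero' (a b : ℕ) (F : ℕ → K) (E : ℕ → ℤ) (hE : 0 ≤ E 0) :
    (∑ᶠ m : ℕ, if m % 2 = (min (a - 1) 0 + min (b - 1) 0) % 2 then F m * Gf t a b 0 m (E m) else 0)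
      = F 0 := by
  rw [finsum_eq_single _ 0]
  · simp [Gf, hE]
  · intro m hm
    simp [Gf, hm]

theorem AT_eq (H : Good t) (a b d : ℕ) : ∀ L l, AT t a b d L l =
    if par a b (d + 1) l then t ^ ((l : ℤ) ^ 2 - 2 * ind (a = d + 2) * l)
      * Gf t a b (d + 1) l (L - l + ind (a = d + 2) + ind (b = d + 2)) else 0 := by
  induction d with
  | zero =>
    intro L l
    rw [AT_zero]
    refine if_congr Iff.rfl ?_ rfl
    rw [Gf, Gf_zero']
    · rw [← mul_assoc, ← zpow_add₀ H.1]
      congr 2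
      · simp; ring
      · simp; ring
    · have := ind_nonneg (a = 0 + 1)
      have := ind_nonneg (b = 0 + 1)
      show (0 : ℤ) ≤ (l : ℤ) - ((0 : ℕ) : ℤ) + ind (a = 0 + 1) + ind (b = 0 + 1)
      push_cast
      linarith [Int.natCast_nonneg l]
  | succ d ih =>
    intro L l
    rw [AT_succ H]
    refine if_congr Iff.rfl ?_ rfl
    rw [Gf, mul_finsum]
    · refine finsum_congr fun m => ?_
      rw [ih, mul_ite, mul_ite, mul_zero, mul_zero]
      refine if_congr Iff.rfl ?_ rfl
      have e : (L : ℤ) + m + ind (a = d + 3) + ind (b = d + 3)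
        = L - l + ind (a = d + 1 + 2) + ind (b = d + 1 + 2) + l + m := by ring
      rw [e]
      generalize Gf t _ _ _ _ _ = Y
      generalize gaussHalf t _ _ = Z
      have : ∀ p q r s : ℤ, p + q = r + s → t ^ p * Z * (t ^ q * Y) = t ^ r * (t ^ s * Z * Y) := by
        intro p q r s h
        have : t ^ p * t ^ q = t ^ r * t ^ s := by
          rw [← zpow_add₀ H.1, ← zpow_add₀ H.1, h]
        linear_combination Z * Y * this
      apply this
      ring_nf

def GI (t : K) (a b e l : ℕ) : K :=
  ∑ᶠ m : ℕ, if m % 2 = (min (a - 1) e + min (b - 1) e) % 2 then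
    t ^ (((l : ℤ) - m) ^ 2 - 2 * ind (a = e + 1) * m)
      * Gf t a b e m (l - m + ind (a = e + 1) + ind (b = e + 1)) else 0

theorem Ssum_eq (H : Good t) (a b d l : ℕ) : Ssum t a b d l =
    if par a b (d + 1) l then t ^ ((l : ℤ) ^ 2 - 2 * ind (a = d + 2) * l) * GI t a b d l else 0 := by
  cases d with
  | zero =>
    rw [Ssum_zero]
    refine if_congr Iff.rfl ?_ rfl
    rw [GI, Gf_zero']
    · rw [← zpow_add₀ H.1]
      congr 1
      simp; ring
    · have := ind_nonneg (a = 0 + 1)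
      have := ind_nonneg (b = 0 + 1)
      show (0 : ℤ) ≤ (l : ℤ) - ((0 : ℕ) : ℤ) + ind (a = 0 + 1) + ind (b = 0 + 1)
      push_cast
      linarith [Int.natCast_nonneg l]
  | succ d =>
    rw [Ssum_succ H]
    refine if_congr Iff.rfl ?_ rfl
    rw [GI, mul_finsum]
    · refine finsum_congr fun m => ?_
      rw [AT_eq H, mul_ite, mul_ite, mul_zero, mul_zero]
      refine if_congr Iff.rfl ?_ rfl
      generalize Gf t _ _ _ _ _ = Y
      have : ∀ p q r s : ℤ, p + q = r + s → t ^ p * (t ^ q * Y) = t ^ r * (t ^ s * Y) := by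
        intro p q r s h
        have : t ^ p * t ^ q = t ^ r * t ^ s := by
          rw [← zpow_add₀ H.1, ← zpow_add₀ H.1, h]
        linear_combination Y * this
      apply this
      ring_nf

lemma Gf_supp (H : Good t) (a b e : ℕ) : ∀ (m : ℕ) (ν : ℤ), Gf t a b e m ν ≠ 0 →
    (m : ℤ) ≤ e * (ν + 2 * (e - 1)) := by
  induction e with
  | zero =>
    intro m ν h
    simp only [Gf] at h
    split_ifs at h with h1
    · simp [h1.1]
    · simp at h
  | succ e ih =>
    intro m ν h
    rw [Gf] at h
    obtain ⟨m', hm'⟩ := exists_ne_of_finsum h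
    split_ifs at hm' with h1
    · have h2 := ih _ _ (right_ne_zero_of_mul hm')
      have h3 := gaussHalf_ne (right_ne_zero_of_mul (left_ne_zero_of_mul hm'))
      have i1 := ind_le (a = e + 1)
      have i2 := ind_le (b = e + 1)
      push_cast
      have hd : (0 : ℤ) ≤ e := by positivity
      nlinarith [mul_le_mul_of_nonneg_left i1 hd, mul_le_mul_of_nonneg_left i2 hd]
    · simp at hm'

lemma GI_finite (H : Good t) (a b e l : ℕ) :
    {m : ℕ | Gf t a b e m (l - m + ind (a = e + 1) + ind (b = e + 1)) ≠ 0}.Finite := by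
  refine (Set.finite_Iic (e * (l + 2 + 2 * e))).subset fun m hm => ?_
  have h2 := Gf_supp H a b e _ _ hm
  have i1 := ind_le (a = e + 1)
  have i2 := ind_le (b = e + 1)
  have hd : (0 : ℤ) ≤ e := by positivity
  rw [Set.mem_Iic]
  zify
  nlinarith [mul_nonneg hd (Int.natCast_nonneg m), mul_le_mul_of_nonneg_left i1 hd, mul_le_mul_of_nonneg_left i2 hd]
end

section
open Filter Topology

/-- `x` has no terms of degree below `D` -/
def sm (D : ℤ) (x : LaurentSeries ℚ) : Prop := Valued.v x ≤ WithZero.exp (-D)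

lemma sm_zero (D : ℤ) : sm D 0 := by simp [sm]

lemma sm_mono {D D' : ℤ} (h : D' ≤ D) {x : LaurentSeries ℚ} (hx : sm D x) : sm D' x :=
  le_trans hx (by rw [WithZero.exp_le_exp]; omega)

lemma sm_add {D : ℤ} {x y : LaurentSeries ℚ} (hx : sm D x) (hy : sm D y) : sm D (x + y) :=
  Valuation.map_add_le _ hx hy

lemma sm_neg {D : ℤ} {x : LaurentSeries ℚ} (hx : sm D x) : sm D (-x) := by
  unfold sm; rwa [Valuation.map_neg]

lemma sm_sub {D : ℤ} {x y : LaurentSeries ℚ} (hx : sm D x) (hy : sm D y) : sm D (x - y) := by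
  rw [sub_eq_add_neg]; exact sm_add hx (sm_neg hy)

lemma sm_mul {D D' : ℤ} {x y : LaurentSeries ℚ} (hx : sm D x) (hy : sm D' y) :
    sm (D + D') (x * y) := by
  unfold sm
  rw [map_mul, show -(D + D') = -D + -D' by ring, WithZero.exp_add]
  exact mul_le_mul' hx hy

lemma sm_mul0 {D : ℤ} {x y : LaurentSeries ℚ} (hx : sm D x) (hy : sm 0 y) : sm D (x * y) := by
  simpa using sm_mul hx hy

lemma sm_mul0' {D : ℤ} {x y : LaurentSeries ℚ} (hx : sm 0 x) (hy : sm D y) : sm D (x * y) := by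
  simpa using sm_mul hx hy

lemma sm_one : sm 0 (1 : LaurentSeries ℚ) := by simp [sm]

lemma sm_sum {ι : Type*} {D : ℤ} (s : Finset ι) (f : ι → LaurentSeries ℚ) (h : ∀ i ∈ s, sm D (f i)) :
    sm D (∑ i ∈ s, f i) := Valuation.map_sum_le _ h

lemma sm_prod {ι : Type*} (s : Finset ι) (f : ι → LaurentSeries ℚ) (h : ∀ i ∈ s, sm 0 (f i)) :
    sm 0 (∏ i ∈ s, f i) := Finset.prod_induction f (sm 0) (fun _ _ => sm_mul0) sm_one h

lemma v_tL (n : ℤ) : Valued.v (tL ^ n) = WithZero.exp (-n) := by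
  have h1 : Valued.v tL = WithZero.exp (-1) := LaurentSeries.valuation_single_zpow ℚ 1
  rw [map_zpow₀, h1, ← WithZero.exp_zsmul]; simp

lemma sm_tL {D n : ℤ} (h : D ≤ n) : sm D (tL ^ n) := by
  unfold sm
  rw [v_tL, WithZero.exp_le_exp]; omega

lemma sm_tL_nat {D : ℤ} {n : ℕ} (h : D ≤ n) : sm D (tL ^ n) := by
  rw [← zpow_natCast]; exact sm_tL h

lemma tL_ne : tL ≠ 0 := by
  intro h
  have := v_tL 1
  rw [h] at this
  simp only [zpow_one, map_zero] at this
  exact WithZero.exp_ne_zero this.symm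

open MonoidWithZeroHom in
lemma nhds_basis : (𝓝 (0 : LaurentSeries ℚ)).HasBasis (fun _ : ℤ => True) (fun D => {x | sm D x}) := by
  refine ⟨fun s => ?_⟩
  rw [Valued.mem_nhds_zero]
  constructor
  · rintro ⟨γ, h⟩
    refine ⟨-(WithZero.log (ValueGroup₀.embedding γ.1) - 1), trivial, fun x hx => h ?_⟩
    rw [Set.mem_ofPred_eq, Valuation.restrict_lt_iff_lt_embedding]
    refine lt_of_le_of_lt hx ?_
    rw [← WithZero.lt_log_iff_exp_lt (by simp)]
    simp
  · rintro ⟨D, -, h⟩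
    refine ⟨Units.mk0 (Valued.v.restrict (tL ^ D)) ?_, fun x hx => h ?_⟩
    · rw [ne_eq, map_eq_zero]; exact zpow_ne_zero _ tL_ne
    · rw [Set.mem_ofPred_eq, Units.val_mk0, Valuation.restrict_lt_iff] at hx
      rw [v_tL] at hx
      exact hx.le

lemma tendsto_sm {ι : Type*} {F : Filter ι} {f : ι → LaurentSeries ℚ} {x : LaurentSeries ℚ} :
    Tendsto f F (𝓝 x) ↔ ∀ D : ℤ, ∀ᶠ i in F, sm D (f i - x) := by
  rw [← tendsto_sub_nhds_zero_iff, nhds_basis.tendsto_right_iff]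
  simp

lemma sm_of_tendsto {ι : Type*} {F : Filter ι} [F.NeBot] {f : ι → LaurentSeries ℚ} {x : LaurentSeries ℚ}
    {D : ℤ} (h : Tendsto f F (𝓝 x)) (hf : ∀ᶠ i in F, sm D (f i)) : sm D x := by
  obtain ⟨i, h1, h2⟩ := ((tendsto_sm.1 h D).and hf).exists
  have := sm_sub h2 h1
  simpa using this

lemma sm_hasSum {ι : Type*} {f : ι → LaurentSeries ℚ} {x : LaurentSeries ℚ}
    {D : ℤ} (h : HasSum f x) (hf : ∀ i, sm D (f i)) : sm D x :=
  sm_of_tendsto h (Eventually.of_forall fun s => sm_sum s f fun i _ => hf i)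

def smG (D : ℤ) : AddSubgroup (LaurentSeries ℚ) where
  carrier := {x | sm D x}
  add_mem' := sm_add
  zero_mem' := sm_zero D
  neg_mem' := sm_neg

lemma nonarch : NonarchimedeanAddGroup (LaurentSeries ℚ) where
  is_nonarchimedean U hU := by
    obtain ⟨D, -, hD⟩ := nhds_basis.mem_iff.1 hU
    exact ⟨⟨smG D, AddSubgroup.isOpen_of_mem_nhds _ (nhds_basis.mem_of_mem (i := D) trivial)⟩, hD⟩

lemma summable_sm {ι : Type*} {f : ι → LaurentSeries ℚ} (h : ∀ D : ℤ, {i | ¬ sm D (f i)}.Finite) :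
    Summable f := by
  haveI := nonarch
  refine NonarchimedeanAddGroup.summable_of_tendsto_cofinite_zero ?_
  rw [tendsto_sm]
  intro D
  simpa [Filter.eventually_cofinite] using h D

lemma good_tL : Good tL := by
  refine ⟨tL_ne, fun n => ?_⟩
  unfold qp
  rw [Finset.prod_ne_zero_iff]
  intro k _ h
  have h2 : Valued.v (tL ^ (4 * (k + 1))) = 1 := by rw [← sub_eq_zero.1 h]; simp
  rw [← zpow_natCast, v_tL, WithZero.exp_eq_one] at h2
  push_cast at h2
  omega

lemma v_fac (k : ℕ) : Valued.v ((1 : LaurentSeries ℚ) - tL ^ (4 * (k + 1))) = 1 := by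
  apply Valuation.map_one_sub_of_lt
  rw [← zpow_natCast, v_tL, ← WithZero.exp_zero, WithZero.exp_lt_exp]
  push_cast; omega

lemma v_qp (n : ℕ) : Valued.v (qp tL n) = 1 := by
  unfold qp
  rw [map_prod]
  exact Finset.prod_eq_one fun k _ => v_fac k

lemma sm_qp (n : ℕ) : sm 0 (qp tL n) := by unfold sm; rw [v_qp]; simp
lemma sm_qp_inv (n : ℕ) : sm 0 (qp tL n)⁻¹ := by unfold sm; rw [map_inv₀, v_qp]; simp

lemma sm_gauss (N m : ℤ) : sm 0 (gauss tL N m) := by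
  unfold gauss
  split_ifs
  · rw [div_eq_mul_inv, mul_inv]
    exact sm_mul0 (sm_qp _) (sm_mul0 (sm_qp_inv _) (sm_qp_inv _))
  · exact sm_zero _

lemma sm_gaussHalf (N m : ℤ) : sm 0 (gaussHalf tL N m) := by
  unfold gaussHalf
  split_ifs
  · exact sm_gauss _ _
  · exact sm_zero _

lemma sm_prod_sub_one {n : ℕ} (s : Finset ℕ) (h : ∀ k ∈ s, n ≤ k) :
    sm n ((∏ k ∈ s, ((1 : LaurentSeries ℚ) - tL ^ (4 * (k + 1)))) - 1) := by
  induction s using Finset.induction_on with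
  | empty => simp [sm_zero]
  | insert k s hk ih =>
    rw [Finset.prod_insert hk]
    have h1 := ih fun j hj => h j (Finset.mem_insert_of_mem hj)
    have h2 := h k (Finset.mem_insert_self _ _)
    have h3 : sm n (tL ^ (4 * (k + 1))) := sm_tL_nat (by push_cast; omega)
    have h4 : sm 0 ((1 : LaurentSeries ℚ) - tL ^ (4 * (k + 1))) := by unfold sm; rw [v_fac]; simp
    have := sm_sub (sm_mul0' h4 h1) h3
    convert this using 1
    ring

lemma multipliable_euler : Multipliable fun k : ℕ => ((1 : LaurentSeries ℚ) - tL ^ (4 * (k + 1))) := by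
  have hc : CauchySeq (fun s : Finset ℕ => ∏ k ∈ s, ((1 : LaurentSeries ℚ) - tL ^ (4 * (k + 1)))) := by
    rw [CauchySeq, IsUniformAddGroup.cauchy_map_iff_tendsto]
    refine ⟨inferInstance, ?_⟩
    rw [tendsto_sm]
    intro D
    have hb : ∀ s : Finset ℕ, Finset.range D.toNat ⊆ s →
      sm D ((∏ k ∈ s, ((1 : LaurentSeries ℚ) - tL ^ (4 * (k + 1))))
        - ∏ k ∈ Finset.range D.toNat, ((1 : LaurentSeries ℚ) - tL ^ (4 * (k + 1)))) := by
      intro s hs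
      rw [← Finset.prod_sdiff hs]
      have h1 := sm_prod_sub_one (n := D.toNat) (s \ Finset.range D.toNat) (by
        intro k hk; simp at hk; omega)
      have h2 : sm 0 (∏ k ∈ Finset.range D.toNat, ((1 : LaurentSeries ℚ) - tL ^ (4 * (k + 1)))) :=
        sm_qp _
      have := sm_mono (D' := D) (by omega) (sm_mul0 h1 h2)
      convert this using 1
      ring
    rw [eventually_iff_exists_mem]
    refine ⟨_, Filter.prod_mem_prod (Filter.mem_atTop (Finset.range D.toNat))
      (Filter.mem_atTop (Finset.range D.toNat)), ?_⟩
    rintro ⟨s, s'⟩ ⟨h1, h2⟩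
    have := sm_sub (hb s h1) (hb s' h2)
    simpa using this
  obtain ⟨x, hx⟩ := CompleteSpace.complete hc
  exact ⟨x, hx⟩

lemma tendsto_qp : Tendsto (qp tL) atTop (𝓝 eulerInf) :=
  multipliable_euler.hasProd.tendsto_prod_nat

lemma euler_ne : eulerInf ≠ 0 := by
  intro h
  have h1 := tendsto_qp
  rw [h, tendsto_sm] at h1
  obtain ⟨n, hn⟩ := (h1 1).exists
  rw [sub_zero] at hn
  unfold sm at hn
  rw [v_qp, ← WithZero.exp_zero, WithZero.exp_le_exp] at hn
  omega

/-- `1/(q)_x`, zero for negative `x` -/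
def ih (x : ℤ) : LaurentSeries ℚ := if 0 ≤ x then (qp tL x.toNat)⁻¹ else 0

lemma sm_ih (x : ℤ) : sm 0 (ih x) := by
  unfold ih; split_ifs
  · exact sm_qp_inv _
  · exact sm_zero _

lemma ih_neg {x : ℤ} (h : x < 0) : ih x = 0 := if_neg (by omega)
lemma ih_nat (n : ℕ) : ih n = (qp tL n)⁻¹ := by simp [ih]
lemma ih_ne {x : ℤ} (h : ih x ≠ 0) : 0 ≤ x := by
  by_contra hc; exact h (ih_neg (by omega))

lemma tendsto_ih : Tendsto ih atTop (𝓝 eulerInf⁻¹) := by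
  have h1 : Tendsto (fun x : ℤ => (qp tL x.toNat)⁻¹) atTop (𝓝 eulerInf⁻¹) := by
    refine (tendsto_qp.comp ?_).inv₀ euler_ne
    exact tendsto_atTop.2 fun n => (eventually_ge_atTop (n : ℤ)).mono fun x hx => by omega
  refine h1.congr' ?_
  filter_upwards [eventually_ge_atTop 0] with x hx
  simp [ih, hx]

lemma tendsto_hh (x : ℤ) : Tendsto (fun u => hh tL x u) atTop (𝓝 (ih x)) := by
  by_cases hx : 0 ≤ x
  · obtain ⟨n, rfl⟩ := Int.eq_ofNat_of_zero_le hx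
    rw [ih_nat]
    have h1 : Tendsto (fun u : ℤ => (qp tL (n + u).toNat) * ((qp tL n)⁻¹ * ih u)) atTop
        (𝓝 (eulerInf * ((qp tL n)⁻¹ * eulerInf⁻¹))) := by
      refine Tendsto.mul (tendsto_qp.comp ?_) (tendsto_const_nhds.mul tendsto_ih)
      exact tendsto_atTop.2 fun k => (eventually_ge_atTop (k : ℤ)).mono fun x hx => by omega
    have e : eulerInf * ((qp tL n)⁻¹ * eulerInf⁻¹) = (qp tL n)⁻¹ := by
      field_simp [euler_ne]
    rw [e] at h1
    refine h1.congr' ?_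
    filter_upwards [eventually_ge_atTop 0] with u hu
    obtain ⟨k, rfl⟩ := Int.eq_ofNat_of_zero_le hu
    rw [hh_nat, ih_nat, ← mul_inv, ← div_eq_mul_inv]
    congr 2
  · rw [ih_neg (by omega)]
    refine tendsto_const_nhds.congr fun u => ?_
    rw [hh_neg_left tL (by omega)]

lemma tendsto_hh' (x : ℤ) : Tendsto (fun u => hh tL u x) atTop (𝓝 (ih x)) := by
  refine (tendsto_hh x).congr fun u => hh_comm _ _ _
end

section
open Filter Topology

lemma tendsto_finsum' {ι : Type*} {S : Set ι} (hS : S.Finite) {f : ℤ → ι → LaurentSeries ℚ}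
    {g : ι → LaurentSeries ℚ} (h0 : ∀ M, ∀ i, i ∉ S → f M i = 0)
    (h : ∀ i, Tendsto (fun M => f M i) atTop (𝓝 (g i))) :
    Tendsto (fun M => ∑ᶠ i, f M i) atTop (𝓝 (∑ᶠ i, g i)) ∧ ∀ i, i ∉ S → g i = 0 := by
  have h1 : ∀ i, i ∉ S → g i = 0 := by
    intro i hi
    refine tendsto_nhds_unique (h i) (tendsto_const_nhds.congr fun M => ?_)
    rw [h0 M i hi]
  refine ⟨?_, h1⟩
  have e : ∀ u : ι → LaurentSeries ℚ, (∀ i, i ∉ S → u i = 0) → ∑ᶠ i, u i = ∑ i ∈ hS.toFinset, u i := by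
    intro u hu
    apply finsum_eq_sum_of_support_subset
    intro i hi
    rw [Set.Finite.coe_toFinset]
    by_contra hc
    exact hi (hu i hc)
  rw [e g h1]
  simp_rw [fun M => e (f M) (h0 M)]
  exact tendsto_finset_sum _ fun i _ => h i

lemma HS_of_tendsto {S : Set ℤ} (hS : S.Finite) {f : ℤ → ℤ → LaurentSeries ℚ}
    {g s : ℤ → LaurentSeries ℚ} {x : LaurentSeries ℚ} (h0 : ∀ M, ∀ i, i ∉ S → f M i = 0)
    (h : ∀ i, Tendsto (fun M => f M i) atTop (𝓝 (g i)))
    (hs : ∀ᶠ M in atTop, HS (f M) (s M)) (hx : Tendsto s atTop (𝓝 x)) : HS g x := by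
  obtain ⟨h1, h2⟩ := tendsto_finsum' hS h0 h
  refine ⟨hS.subset fun i hi => ?_, ?_⟩
  · by_contra hc; exact hi (h2 i hc)
  · refine tendsto_nhds_unique h1 (hx.congr' ?_)
    filter_upwards [hs] with M hM using hM.2.symm

lemma GI_lim (a b e l : ℕ) (δ : ℤ)
    (hδ : ∀ m : ℕ, m % 2 = (min (a - 1) e + min (b - 1) e) % 2 → (δ + l + m) % 2 = 0) :
    Tendsto (fun M : ℤ => Gf tL a b (e + 1) l (2 * M + δ)) atTop (𝓝 (ih l * GI tL a b e l)) := by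
  simp only [Gf]
  unfold GI
  rw [mul_finsum]
  refine (tendsto_finsum' (GI_finite good_tL a b e l) ?_ ?_).1
  · intro M m hm
    have : Gf tL a b e m (l - m + ind (a = e + 1) + ind (b = e + 1)) = 0 := by
      by_contra hc; exact hm hc
    rw [this]; simp
  · intro m
    by_cases hp : m % 2 = (min (a - 1) e + min (b - 1) e) % 2
    · simp only [if_pos hp]
      have h1 := hδ m hp
      have h2 : Tendsto (fun M : ℤ => gaussHalf tL (2 * M + δ + l + m) l) atTop (𝓝 (ih l)) := by
        have h3 : Tendsto (fun M : ℤ => M + (δ + m - l) / 2) atTop atTop :=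
          tendsto_atTop_add_const_right _ _ tendsto_id
        refine ((tendsto_hh l).comp h3).congr fun M => ?_
        simp only [Function.comp]
        unfold gaussHalf hh
        rw [if_pos (by omega)]
        congr 1
        omega
      have h4 := (h2.const_mul (tL ^ (((l : ℤ) - m) ^ 2 - 2 * ind (a = e + 1) * m))).mul_const
        (Gf tL a b e m (l - m + ind (a = e + 1) + ind (b = e + 1)))
      convert h4 using 2
      ring
    · simp only [if_neg hp, mul_zero]
      exact tendsto_const_nhds

def phiI (P a b c j : ℤ) : LaurentSeries ℚ :=
  tL ^ (4 * (j * (P * j + b))) * (ih (P * j + b + c) * ih (a + c - P * j)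
    - ih (P * j + a + b + c) * ih (c - P * j))

lemma abs_le_mul {P j B : ℤ} (hP : 1 ≤ P) (h1 : -B ≤ P * j) (h2 : P * j ≤ B) : -B ≤ j ∧ j ≤ B := by
  constructor
  · by_contra hc
    nlinarith
  · by_contra hc
    nlinarith

lemma Phi_lim {P a b c δ : ℤ} (hP : 1 ≤ P) (ha : 0 ≤ a) (hb : 0 ≤ b) :
    Tendsto (fun M => Phi tL P a b c M δ) atTop (𝓝 (∑ᶠ j, phiI P a b c j)) := by
  unfold Phi
  have hS : (Set.Icc (-(a + b + |c|)) (a + b + |c|)).Finite := Set.finite_Icc _ _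
  refine (tendsto_finsum' hS ?_ ?_).1
  · intro M j hj
    by_contra hc
    apply hj
    have hc1 := neg_abs_le c
    have hc2 := le_abs_self c
    have : -(a + b + |c|) ≤ P * j ∧ P * j ≤ a + b + |c| := by
      unfold phiT at hc
      by_cases h1 : hh tL (P * j + b + c) (M - j) * hh tL (a + c - P * j) (M + δ + j) = 0
      · rw [h1, zero_sub] at hc
        have h2 := neg_ne_zero.1 (right_ne_zero_of_mul hc)
        have h3 := hh_ne tL (left_ne_zero_of_mul h2)
        have h4 := hh_ne tL (right_ne_zero_of_mul h2)
        constructor <;> linarith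
      · have h3 := hh_ne tL (left_ne_zero_of_mul h1)
        have h4 := hh_ne tL (right_ne_zero_of_mul h1)
        constructor <;> linarith
    exact abs_le_mul hP this.1 this.2
  · intro j
    have t1 : Tendsto (fun M : ℤ => M - j) atTop atTop := tendsto_atTop_add_const_right _ _ tendsto_id
    have t2 : Tendsto (fun M : ℤ => M + δ + j) atTop atTop := by
      simp_rw [add_assoc]
      exact tendsto_atTop_add_const_right _ _ tendsto_id
    unfold phiT phiI
    exact Tendsto.const_mul _ ((((tendsto_hh _).comp t1).mul ((tendsto_hh _).comp t2)).sub
      (((tendsto_hh _).comp t1).mul ((tendsto_hh _).comp t2)))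

/-- the limiting bosonic form of the truncated fermionic sums -/
theorem Ssum_bos (e a b l : ℕ) (c : ℤ) (ha : 1 ≤ a) (ha' : a ≤ e + 1) (hb : 1 ≤ b) (hb' : b ≤ e + 2)
    (hl : (l : ℤ) = a + b + 2 * c) :
    ih l * Ssum tL a b e l = tL ^ ((l : ℤ) ^ 2 + (b - a)) * ∑ᶠ j, phiI (e + 3) a b c j := by
  rw [Ssum_eq good_tL, if_pos (by unfold par; omega), ind_neg (by omega)]
  obtain ⟨hW, hV, -, -⟩ := claim good_tL a b ha hb (e + 1)
  have key : ih l * GI tL a b e l = tL ^ ((b : ℤ) - a) * ∑ᶠ j, phiI (e + 3) a b c j := by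
    by_cases h : b ≤ e + 1
    · refine tendsto_nhds_unique (GI_lim a b e l 0 (by intro m hm; omega)) ?_
      refine ((Phi_lim (δ := 0) (by omega) (by omega) (by omega)).const_mul _).congr fun M => ?_
      rw [add_zero, hW ha' h c M l hl]
      push_cast
      ring_nf
    · obtain rfl : b = e + 2 := by omega
      refine tendsto_nhds_unique (GI_lim a (e + 2) e l 1 (by intro m hm; omega)) ?_
      refine ((Phi_lim (δ := 1) (by omega) (by omega) (by omega)).const_mul _).congr fun M => ?_
      rw [hV ha' (by omega) c M l (by omega)]
      push_cast
      ring_nf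
  rw [zpow_add₀ tL_ne, mul_left_comm, key]
  simp [mul_assoc]

/-- limiting Bailey step -/
theorem bailey (w n : ℤ) :
    HS (fun k => tL ^ (4 * (k * (k + n))) * ih (w - k) * ih k * ih (k + n)) (ih w * ih (w + n)) := by
  have hS : (Set.Icc 0 w).Finite := Set.finite_Icc _ _
  refine HS_of_tendsto hS (f := fun A k => bT tL A A n w k)
    (s := fun A => hh tL (A + n) w * hh tL (A - n) (w + n)) ?_ ?_ ?_ ?_
  · intro A k hk
    by_contra hc
    obtain ⟨h1, h2, h3⟩ := ne3 (show _ * _ * _ * _ ≠ 0 from hc)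
    have := hh_ne tL h1
    have := hh_ne tL h2
    exact hk ⟨by omega, by omega⟩
  · intro k
    unfold bT
    have t0 : Tendsto (fun A : ℤ => A + A) atTop atTop := tendsto_id.atTop_add_atTop tendsto_id
    have t1 : Tendsto (fun A : ℤ => A - k) atTop atTop := tendsto_atTop_add_const_right _ _ tendsto_id
    have t2 : Tendsto (fun A : ℤ => A - n - k) atTop atTop := by
      simp_rw [sub_eq_add_neg, add_assoc]
      exact tendsto_atTop_add_const_right _ _ tendsto_id
    exact (((tendsto_hh' _).comp t0).const_mul _ |>.mul ((tendsto_hh' _).comp t1)).mul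
      ((tendsto_hh' _).comp t2)
  · filter_upwards [eventually_ge_atTop 0] with A hA
    obtain ⟨m, rfl⟩ := Int.eq_ofNat_of_zero_le hA
    exact burge good_tL m w m n hA
  · have t1 : Tendsto (fun A : ℤ => A + n) atTop atTop := tendsto_atTop_add_const_right _ _ tendsto_id
    have t2 : Tendsto (fun A : ℤ => A - n) atTop atTop := tendsto_atTop_add_const_right _ _ tendsto_id
    exact ((tendsto_hh' _).comp t1).mul ((tendsto_hh' _).comp t2)

lemma finite_sq_lt (N D : ℤ) : {y : ℤ | y * (y + N) < D}.Finite := by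
  refine (Set.finite_Icc (-(|N| + |D|)) (|N| + |D|)).subset fun y hy => ?_
  have h1 := neg_abs_le N
  have h2 := le_abs_self N
  have h3 := le_abs_self D
  have h4 := abs_nonneg D
  have h5 := abs_nonneg N
  have hy' : y * (y + N) < D := hy
  constructor
  · by_contra hc
    nlinarith
  · by_contra hc
    nlinarith

lemma durfee_summable (N : ℤ) :
    Summable (fun y : ℤ => tL ^ (4 * (y * (y + N))) * ih y * ih (y + N)) := by
  refine summable_sm fun D => (finite_sq_lt N (|D| + 1)).subset fun y hy => ?_
  by_contra hc
  have hc' : |D| + 1 ≤ y * (y + N) := not_lt.1 hc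
  have := le_abs_self D
  have := abs_nonneg D
  exact hy (sm_mul0 (sm_mul0 (sm_tL (by omega)) (sm_ih _)) (sm_ih _))

theorem durfee (N : ℤ) :
    HasSum (fun y : ℤ => tL ^ (4 * (y * (y + N))) * ih y * ih (y + N)) eulerInf⁻¹ := by
  have hs := durfee_summable N
  set f := (fun y : ℤ => tL ^ (4 * (y * (y + N))) * ih y * ih (y + N)) with hf
  obtain ⟨s, hs⟩ := hs
  have key : ∀ w, HasSum (fun k => f k * ih (w - k)) (ih w * ih (w + N)) := by
    intro w
    have h := bailey w N
    rw [← h.2]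
    have h2 : ∀ k, f k * ih (w - k) = tL ^ (4 * (k * (k + N))) * ih (w - k) * ih k * ih (k + N) := by
      intro k; rw [hf]; ring
    simp_rw [h2]
    rw [finsum_eq_sum _ h.1]
    apply hasSum_sum_of_ne_finset_zero
    intro k hk
    by_contra hc
    exact hk (h.1.mem_toFinset.2 hc)
  have lim1 : Tendsto (fun w => ih w * ih (w + N)) atTop (𝓝 (eulerInf⁻¹ * eulerInf⁻¹)) :=
    tendsto_ih.mul (tendsto_ih.comp (tendsto_atTop_add_const_right _ _ tendsto_id))
  have lim2 : Tendsto (fun w => ih w * ih (w + N)) atTop (𝓝 (s * eulerInf⁻¹)) := by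
    rw [tendsto_sm]
    intro D
    have hfin : ∀ᶠ k in cofinite, sm D (f k) := by
      have := hs.summable.tendsto_cofinite_zero
      rw [tendsto_sm] at this
      simpa using this D
    have hE : sm 0 eulerInf⁻¹ := sm_of_tendsto tendsto_ih (Eventually.of_forall sm_ih)
    have hf0 : ∀ k : ℤ, ∃ D0 : ℤ, sm D0 (f k) := fun k =>
      ⟨4 * (k * (k + N)), sm_mul0 (sm_mul0 (sm_tL le_rfl) (sm_ih _)) (sm_ih _)⟩
    have hev : ∀ᶠ w in atTop, ∀ k ∈ (Filter.eventually_cofinite.1 hfin).toFinset,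
        sm D (f k * ih (w - k) - f k * eulerInf⁻¹) := by
      rw [Filter.eventually_all_finset]
      intro k _
      have : Tendsto (fun w => f k * ih (w - k)) atTop (𝓝 (f k * eulerInf⁻¹)) :=
        (tendsto_ih.comp (tendsto_atTop_add_const_right _ _ tendsto_id)).const_mul _
      exact tendsto_sm.1 this D
    filter_upwards [hev] with w hw
    refine sm_hasSum ((key w).sub (hs.mul_right eulerInf⁻¹)) fun k => ?_
    by_cases hk : sm D (f k)
    · exact sm_sub (sm_mul0 hk (sm_ih _)) (sm_mul0 hk hE)
    · exact hw k (by simpa using hk)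
  have := tendsto_nhds_unique lim1 lim2
  have := mul_right_cancel₀ (inv_ne_zero euler_ne) this
  rw [this]; exact hs
end

section
open Filter Topology

/-- the tadpole quadratic form appearing in the statement -/
def tadT (k : ℕ) (n : Fin k → ℕ) (l : ℤ) : ℤ :=
  tadB k (fun i => 2 * (n i : ℤ) + l * (if (i : ℕ) + 1 = k then 1 else 0))
    (fun i => 2 * (n i : ℤ) + l * (if (i : ℕ) + 1 = k then 1 else 0))

lemma tadB_eps (k : ℕ) (v : Fin k → ℤ) (X : ℤ) :
    tadB k (fun i => v i + X * (if (i : ℕ) + 1 = k then 1 else 0))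
      (fun i => v i + X * (if (i : ℕ) + 1 = k then 1 else 0))
      = tadB k v v + 2 * X * ∑ i : Fin k, ((i : ℕ) + 1 : ℤ) * v i + k * X ^ 2 := by
  cases k with
  | zero => simp [tadB]
  | succ k =>
    have e1 : ∀ i : Fin (k + 1), (if (i : ℕ) + 1 = k + 1 then (1 : ℤ) else 0)
        = if i = Fin.last k then 1 else 0 := by
      intro i
      refine if_congr ?_ rfl rfl
      rw [Fin.ext_iff, Fin.val_last]; omega
    simp only [e1]
    have e2 : ∀ i : Fin (k + 1), (min (((i : ℕ) : ℤ) + 1) ((k : ℤ) + 1)) = (i : ℕ) + 1 := by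
      intro i
      have := i.2
      rw [min_eq_left]; omega
    have e3 : ∀ i : Fin (k + 1), (min ((k : ℤ) + 1) (((i : ℕ) : ℤ) + 1)) = (i : ℕ) + 1 := by
      intro i
      rw [min_comm, e2]
    unfold tadB
    simp only [mul_add, add_mul, Finset.sum_add_distrib, mul_ite, ite_mul, mul_one, mul_zero, zero_mul,
      Finset.sum_ite_eq', Finset.mem_univ, if_true, Finset.sum_ite_irrel, Finset.sum_const_zero, Fin.val_last, e2, e3]
    push_cast
    simp only [Finset.mul_sum, Finset.sum_add_distrib]
    have e4 : ∑ x : Fin (k+1), v x * ((x : ℕ) : ℤ) * X = ∑ x : Fin (k+1), X * (((x : ℕ) : ℤ) * v x) :=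
      Finset.sum_congr rfl fun _ _ => by ring
    have e5 : ∑ x : Fin (k+1), X * ((x : ℕ) : ℤ) * v x = ∑ x : Fin (k+1), X * (((x : ℕ) : ℤ) * v x) :=
      Finset.sum_congr rfl fun _ _ => by ring
    rw [e4, e5]
    simp only [mul_assoc, ← Finset.mul_sum, ← Finset.sum_mul, one_mul]
    ring

lemma tadT_zero (n : Fin 0 → ℕ) (l : ℤ) : tadT 0 n l = 0 := by simp [tadT, tadB]

lemma tadT_snoc (k : ℕ) (n : Fin k → ℕ) (x : ℕ) (l : ℤ) :
    tadT (k + 1) (Fin.snoc n x) l = (2 * x + l) ^ 2 + tadT k n (2 * x + l) := by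
  unfold tadT
  rw [tadB_eps k (fun i => 2 * (n i : ℤ))]
  have e2 : ∀ i : Fin k, (min (((i : ℕ) : ℤ) + 1) ((k : ℤ) + 1)) = (i : ℕ) + 1 := by
    intro i
    have := i.2
    rw [min_eq_left]; omega
  have e3 : ∀ i : Fin k, (min ((k : ℤ) + 1) (((i : ℕ) : ℤ) + 1)) = (i : ℕ) + 1 := by
    intro i
    rw [min_comm, e2]
  have e4 : ∀ i : Fin k, ¬ ((i : ℕ) = k) := fun i => i.2.ne
  unfold tadB
  simp only [Fin.sum_univ_castSucc, Fin.snoc_castSucc, Fin.snoc_last, Fin.val_castSucc, Fin.val_last, Finset.sum_add_distrib, e2, e3,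
    add_left_inj, e4, if_false, if_true, mul_zero, add_zero, mul_one, min_self]
  have e5 : ∑ i : Fin k, 2 * (n i : ℤ) * (((i : ℕ) : ℤ) + 1) * (2 * x + l)
      = (2 * x + l) * ∑ i : Fin k, (((i : ℕ) : ℤ) + 1) * (2 * (n i : ℤ)) := by
    rw [Finset.mul_sum]; exact Finset.sum_congr rfl fun _ _ => by ring
  have e6 : ∑ i : Fin k, (2 * x + l) * (((i : ℕ) : ℤ) + 1) * (2 * (n i : ℤ))
      = (2 * x + l) * ∑ i : Fin k, (((i : ℕ) : ℤ) + 1) * (2 * (n i : ℤ)) := by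
    rw [Finset.mul_sum]; exact Finset.sum_congr rfl fun _ _ => by ring
  rw [e5, e6]; ring

lemma tadT_bound (k : ℕ) : ∀ (n : Fin k → ℕ) (l : ℤ), 0 ≤ l → ∑ i, (n i : ℤ) ≤ tadT k n l := by
  induction k with
  | zero => intro n l _; simp [tadT_zero]
  | succ k ihk =>
    intro n l hl
    obtain ⟨n', x, rfl⟩ : ∃ (n' : Fin k → ℕ) (x : ℕ), n = Fin.snoc n' x :=
      ⟨Fin.init n, n (Fin.last k), by rw [Fin.snoc_init_self]⟩
    rw [tadT_snoc, Fin.sum_univ_castSucc]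
    simp only [Fin.snoc_castSucc, Fin.snoc_last]
    have := ihk n' (2 * x + l) (by positivity)
    have h0 : (0 : ℤ) ≤ x := by positivity
    rcases h0.eq_or_lt with h | h
    · rw [← h] at this ⊢; nlinarith
    · nlinarith
end

section
open Filter Topology

lemma finite_sum_le (k : ℕ) (D : ℤ) : {n : Fin k → ℕ | ∑ i, (n i : ℤ) ≤ D}.Finite := by
  refine (Set.Finite.pi (fun _ : Fin k => Set.finite_Iic D.toNat)).subset fun n hn => ?_
  simp only [Set.mem_ofPred_eq] at hn
  simp only [Set.mem_univ_pi, Set.mem_Iic]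
  intro i
  have : (n i : ℤ) ≤ ∑ i, (n i : ℤ) :=
    Finset.single_le_sum (f := fun i => (n i : ℤ)) (fun _ _ => by positivity) (Finset.mem_univ i)
  omega

lemma finite_abs_le (D : ℤ) : {z : ℤ | |z| ≤ D}.Finite := by
  refine (Set.finite_Icc (-D) D).subset fun z hz => ?_
  exact abs_le.1 hz

lemma abs_le_sq (z : ℤ) : |z| ≤ z ^ 2 := by
  rw [← sq_abs]
  have := abs_nonneg z
  rcases this.eq_or_lt with h | h
  · rw [← h]; norm_num
  · nlinarith

lemma finite_lin (N D : ℤ) : {z : ℤ | |N + 2 * z| ≤ D}.Finite := by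
  refine (finite_abs_le D).preimage (f := fun z : ℤ => N + 2 * z) ?_
  intro x _ y _ h
  simp only at h; omega

/-- product of the inverse factorials -/
def pih {k : ℕ} (n : Fin k → ℕ) : LaurentSeries ℚ := ∏ i, ih (n i)

lemma sm_pih {k : ℕ} (n : Fin k → ℕ) : sm 0 (pih n) := sm_prod _ _ fun _ _ => sm_ih _

def chT (k : ℕ) (N : ℤ) (n : Fin k → ℕ) (y : ℤ) : LaurentSeries ℚ :=
  tL ^ (tadT k n (N + 2 * y) + (N + 2 * y) ^ 2) * (ih (N + y) * ih y) * pih n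

lemma ih_mul_ne {x y : ℤ} (h : ih x * ih y ≠ 0) : 0 ≤ x ∧ 0 ≤ y := by
  constructor
  · by_contra hc; exact h (by rw [ih_neg (by omega), zero_mul])
  · by_contra hc; exact h (by rw [ih_neg (x := y) (by omega), mul_zero])

/-- summability on the level of the Bailey lemma -/
lemma step_summable (k : ℕ) (N : ℤ) : Summable (fun p : ((Fin k → ℕ) × ℤ) × ℤ =>
    tL ^ (tadT k p.1.1 (N + 2 * p.1.2) + (N + 2 * p.1.2) ^ 2) * pih p.1.1 *
      (tL ^ ((N + 2 * p.2) ^ 2) * ih (p.1.2 - p.2) * ih p.2 * ih (p.2 + N))) := by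
  refine summable_sm fun D => ?_
  refine (((finite_sum_le k |D|).prod (finite_lin N |D|)).prod (finite_lin N |D|)).subset ?_
  rintro ⟨⟨n, z⟩, y⟩ h
  simp only [Set.mem_ofPred_eq] at h
  have h0 : 0 ≤ z - y ∧ 0 ≤ y ∧ 0 ≤ y + N := by
    refine ⟨?_, ?_, ?_⟩ <;> by_contra hc <;> refine h ?_
    · rw [ih_neg (x := z - y) (by omega)]; simpa using sm_zero D
    · rw [ih_neg (x := y) (by omega)]; simpa using sm_zero D
    · rw [ih_neg (x := y + N) (by omega)]; simpa using sm_zero D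
  have hb := tadT_bound k n (N + 2 * z) (by omega)
  have hD : (tadT k n (N + 2 * z) + (N + 2 * z) ^ 2) + (N + 2 * y) ^ 2 < D := by
    by_contra hc
    refine h (sm_mono (not_lt.1 hc) (sm_mul (sm_mul0 (sm_tL le_rfl) (sm_pih _)) ?_))
    exact sm_mul0 (sm_mul0 (sm_mul0 (sm_tL le_rfl) (sm_ih _)) (sm_ih _)) (sm_ih _)
  have h1 := abs_le_sq (N + 2 * z)
  have h2 := abs_le_sq (N + 2 * y)
  have h3 := abs_nonneg (N + 2 * z)
  have h4 := abs_nonneg (N + 2 * y)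
  have h5 := le_abs_self D
  have h6 : 0 ≤ ∑ i, (n i : ℤ) := Finset.sum_nonneg fun _ _ => by positivity
  refine ⟨⟨?_, ?_⟩, ?_⟩
  · show ∑ i, (n i : ℤ) ≤ |D|
    linarith
  · show |N + 2 * z| ≤ |D|
    linarith
  · show |N + 2 * y| ≤ |D|
    linarith

lemma hasSum_of_HS {f : ℤ → LaurentSeries ℚ} {s : LaurentSeries ℚ} (h : HS f s) : HasSum f s := by
  rw [← h.2, finsum_eq_sum _ h.1]
  apply hasSum_sum_of_ne_finset_zero
  intro k hk
  by_contra hc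
  exact hk (h.1.mem_toFinset.2 hc)

lemma HSc {ι : Type*} {f g : ι → LaurentSeries ℚ} {s t : LaurentSeries ℚ} (h : HasSum f s)
    (hf : ∀ i, g i = f i) (hs : t = s) : HasSum g t := by
  rw [hs, funext hf]; exact h

/-- index map of the Bailey step -/
def stepMap (k : ℕ) (p : (Fin (k + 1) → ℕ) × ℤ) : ((Fin k → ℕ) × ℤ) × ℤ :=
  ((Fin.init p.1, (p.1 (Fin.last k) : ℤ) + p.2), p.2)

lemma stepMap_inj (k : ℕ) : Function.Injective (stepMap k) := by
  rintro ⟨n, y⟩ ⟨n', y'⟩ h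
  simp only [stepMap, Prod.mk.injEq] at h
  obtain ⟨⟨h1, h2⟩, h3⟩ := h
  have h4 : n (Fin.last k) = n' (Fin.last k) := by omega
  rw [Prod.mk.injEq]
  refine ⟨?_, h3⟩
  rw [← Fin.snoc_init_self n, ← Fin.snoc_init_self n', h1, h4]

theorem chain (k : ℕ) (N : ℤ) : HasSum (fun p : (Fin k → ℕ) × ℤ => chT k N p.1 p.2)
    (tL ^ ((k + 1) * N ^ 2) * eulerInf⁻¹) := by
  induction k with
  | zero =>
    have h := (durfee N).mul_left (tL ^ (N ^ 2))
    have e : (fun p : (Fin 0 → ℕ) × ℤ => chT 0 N p.1 p.2)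
        = (fun y : ℤ => tL ^ (N ^ 2) * (tL ^ (4 * (y * (y + N))) * ih y * ih (y + N))) ∘
          (Equiv.uniqueProd ℤ (Fin 0 → ℕ)) := by
      funext p
      obtain ⟨n, y⟩ := p
      simp only [Function.comp, Equiv.uniqueProd_apply, chT, tadT_zero, pih, Finset.univ_eq_empty,
        Finset.prod_empty, mul_one]
      rw [show 0 + (N + 2 * y) ^ 2 = N ^ 2 + 4 * (y * (y + N)) by ring, zpow_add₀ tL_ne, add_comm y N]
      ring
    rw [e, Equiv.hasSum_iff]
    simpa using h
  | succ k ihk =>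
    have hs := step_summable k N
    have hin : ∀ p : (Fin k → ℕ) × ℤ, HasSum (fun y : ℤ =>
        tL ^ (tadT k p.1 (N + 2 * p.2) + (N + 2 * p.2) ^ 2) * pih p.1 *
          (tL ^ ((N + 2 * y) ^ 2) * ih (p.2 - y) * ih y * ih (y + N)))
          (tL ^ (N ^ 2) * chT k N p.1 p.2) := by
      rintro ⟨n, z⟩
      have h := ((hasSum_of_HS (bailey z N)).mul_left (tL ^ (N ^ 2))).mul_left
        (tL ^ (tadT k n (N + 2 * z) + (N + 2 * z) ^ 2) * pih n)
      refine HSc h (fun y => ?_) ?_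
      · simp only
        rw [show (N + 2 * y) ^ 2 = N ^ 2 + 4 * (y * (y + N)) by ring, zpow_add₀ tL_ne (N ^ 2)]
        ring
      · simp only [chT]
        rw [add_comm z N]; ring
    have h1 := hs.hasSum.prod_fiberwise hin
    have h2 := ihk.mul_left (tL ^ (N ^ 2))
    have h3 := h1.unique h2
    have h4 := hs.hasSum
    rw [h3] at h4
    rw [← (stepMap_inj k).hasSum_iff] at h4
    · refine HSc h4 (fun p => ?_) ?_
      · obtain ⟨n, y⟩ := p
        obtain ⟨n', x, rfl⟩ : ∃ (n' : Fin k → ℕ) (x : ℕ), n = Fin.snoc n' x :=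
          ⟨Fin.init n, n (Fin.last k), by rw [Fin.snoc_init_self]⟩
        simp only [Function.comp, stepMap, chT, Fin.init_snoc, Fin.snoc_last, tadT_snoc, pih,
          Fin.prod_univ_castSucc, Fin.snoc_castSucc]
        rw [show N + 2 * ((x : ℤ) + y) = 2 * x + (N + 2 * y) by ring,
          show (x : ℤ) + y - y = x by ring, add_comm y N, add_comm ((2 * (x : ℤ) + (N + 2 * y)) ^ 2), zpow_add₀ tL_ne (_ + _)]
        ring
      · rw [← mul_assoc, ← zpow_add₀ tL_ne]
        congr 2
        push_cast; ring
    · rintro ⟨⟨n, z⟩, y⟩ h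
      simp only
      by_cases hc : 0 ≤ z - y
      · exfalso
        refine h ⟨(Fin.snoc n (z - y).toNat, y), ?_⟩
        simp only [stepMap, Fin.init_snoc, Fin.snoc_last]
        rw [Int.toNat_of_nonneg hc]; simp
      · rw [ih_neg (x := z - y) (by omega)]; simp
end

section
open Filter Topology

lemma mAt_nonpos (d : ℕ) (m : Fin d → ℕ) (s : ℤ) (hs : s ≤ 0) : mAt d m s = 0 := by
  unfold mAt uv
  refine Finset.sum_eq_zero fun i _ => ?_
  rw [if_neg (by omega), zero_mul]

lemma quadC_ge (d : ℕ) : ∀ m : Fin (d + 1) → ℕ, (m 0 : ℤ) ^ 2 ≤ quadC (d + 1) m := by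
  induction d with
  | zero => intro m; rw [quadC_one]; nlinarith [sq_nonneg (m 0 : ℤ)]
  | succ d ihd =>
    intro m
    rw [← Fin.cons_self_tail m, quadC_cons, Fin.cons_zero]
    have := ihd (Fin.tail m)
    nlinarith [sq_nonneg ((m 0 : ℤ) - Fin.tail m 0)]

lemma expo_ge (d : ℕ) : ∀ (m : Fin (d + 1) → ℕ) (s : ℤ),
    (m 0 : ℤ) ^ 2 - 2 * m 0 - (d + 1) ≤ quadC (d + 1) m - 2 * mAt (d + 1) m s := by
  induction d with
  | zero =>
    intro m s
    rw [quadC_one]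
    have : mAt (0 + 1) m s ≤ m 0 := by
      show ∑ i : Fin 1, uv 1 s i * (m i : ℤ) ≤ m 0
      rw [Fin.sum_univ_one]
      unfold uv
      split_ifs <;> simp
    push_cast
    nlinarith [sq_nonneg (m 0 : ℤ)]
  | succ d ihd =>
    intro m s
    rw [← Fin.cons_self_tail m, quadC_cons, Fin.cons_zero, show s = (s - 1) + 1 by ring, mAt_cons]
    have h2 := quadC_ge d (Fin.tail m)
    have h3 := ihd (Fin.tail m) (s - 1)
    by_cases hs : s - 1 = 0
    · have h4 := mAt_nonpos (d + 1) (Fin.tail m) (s - 1) hs.le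
      rw [h4]
      simp only [ind, hs, if_true]
      push_cast
      nlinarith [sq_nonneg ((m 0 : ℤ) - Fin.tail m 0)]
    · simp only [ind, hs, if_false]
      push_cast
      nlinarith [sq_nonneg ((m 0 : ℤ) - Fin.tail m 0 + 1)]

/-- the summand over `m` -/
def rT (k e a b : ℕ) (n : Fin k → ℕ) (m : Fin (e + 1) → ℕ) : LaurentSeries ℚ :=
  tL ^ (tadT k n (m 0)) * pih n * ih (m 0) * sT tL a b e m

lemma sm_sT (e a b : ℕ) (m : Fin (e + 1) → ℕ) :
    sm ((m 0 : ℤ) ^ 2 - 2 * m 0 - (e + 1)) (sT tL a b e m) := by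
  unfold sT
  split_ifs
  · refine sm_mul0 (sm_tL (expo_ge e m _)) (sm_prod _ _ fun i _ => ?_)
    split_ifs
    · exact sm_gaussHalf _ _
    · exact sm_one
  · exact sm_zero _

lemma rT_summable (k e a b : ℕ) (n : Fin k → ℕ) : Summable (rT k e a b n) := by
  refine summable_sm fun D => ?_
  refine Set.Finite.subset (s := ⋃ l ∈ Set.Iic ((|D| + e + 3).toNat),
      Set.image (fun rest : Fin e → ℕ => (Fin.cons l rest : Fin (e + 1) → ℕ))
        {rest : Fin e → ℕ | sT tL a b e (Fin.cons l rest) ≠ 0}) ?_ ?_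
  · exact (Set.finite_Iic _).biUnion fun l _ => (sT_finite good_tL a b e l).image _
  · intro m h
    simp only [Set.mem_ofPred_eq] at h
    simp only [Set.mem_iUnion]
    refine ⟨m 0, ?_, Fin.tail m, ?_, Fin.cons_self_tail m⟩
    · by_contra hc
      simp only [Set.mem_Iic, not_le] at hc
      have hc' : |D| + e + 3 < (m 0 : ℤ) := by omega
      have hb := tadT_bound k n (m 0) (by positivity)
      have h6 : 0 ≤ ∑ i, (n i : ℤ) := Finset.sum_nonneg fun _ _ => by positivity
      refine h (sm_mono ?_ (sm_mul (sm_mul0 (sm_mul0 (sm_tL (h6.trans hb)) (sm_pih n)) (sm_ih _)) (sm_sT e a b m)))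
      have := le_abs_self D
      have := abs_nonneg D
      nlinarith
    · simp only [Set.mem_ofPred_eq]
      rw [Fin.cons_self_tail]
      intro h0
      refine h ?_
      unfold rT
      rw [h0, mul_zero]
      exact sm_zero D

lemma rT_fiber (k e a b : ℕ) (n : Fin k → ℕ) :
    HasSum (fun l : ℕ => tL ^ (tadT k n l) * pih n * (ih l * Ssum tL a b e l)) (∑' m, rT k e a b n m) := by
  have h := (rT_summable k e a b n).hasSum
  rw [← (Fin.consEquiv (fun _ : Fin (e + 1) => ℕ)).hasSum_iff] at h
  refine HasSum.prod_fiberwise h fun l => ?_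
  have hf := sT_finite good_tL a b e l
  have h1 : HasSum (fun rest : Fin e → ℕ => sT tL a b e (Fin.cons l rest)) (Ssum tL a b e l) := by
    unfold Ssum
    rw [finsum_eq_sum _ hf]
    apply hasSum_sum_of_ne_finset_zero
    intro k hk
    by_contra hc
    exact hk (hf.mem_toFinset.2 hc)
  refine HSc (h1.mul_left (tL ^ (tadT k n l) * pih n * ih l)) (fun rest => ?_) (by ring)
  rfl

lemma phiI_neg (P a b c : ℤ) (h : a + b + 2 * c < 0) (j : ℤ) : phiI P a b c j = 0 := by
  unfold phiI
  have h1 : ih (P * j + b + c) * ih (a + c - P * j) = 0 := by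
    by_contra hc
    have := ih_mul_ne hc
    omega
  have h2 : ih (P * j + a + b + c) * ih (c - P * j) = 0 := by
    by_contra hc
    have := ih_mul_ne hc
    omega
  rw [h1, h2]; simp

theorem rT_bos (k e a b : ℕ) (n : Fin k → ℕ) (ha : 1 ≤ a) (ha' : a ≤ e + 1) (hb : 1 ≤ b) (hb' : b ≤ e + 2) :
    HasSum (fun c : ℤ => tL ^ (tadT k n (a + b + 2 * c)) * pih n *
      (tL ^ (((a : ℤ) + b + 2 * c) ^ 2 + (b - a)) * ∑ᶠ j, phiI (e + 3) a b c j)) (∑' m, rT k e a b n m) := by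
  have h := rT_fiber k e a b n
  set g := (fun l : ℕ => tL ^ (tadT k n l) * pih n * (ih l * Ssum tL a b e l)) with hg
  set g' : ℤ → LaurentSeries ℚ := fun l => if 0 ≤ l then g l.toNat else 0 with hg'
  have e1 : g = g' ∘ (Nat.cast : ℕ → ℤ) := by
    funext l
    simp [hg']
  rw [e1, Function.Injective.hasSum_iff Nat.cast_injective] at h
  · have inj : Function.Injective (fun c : ℤ => (a : ℤ) + b + 2 * c) := by
      intro x y hxy; simp only at hxy; omega
    rw [← inj.hasSum_iff] at h
    · refine HSc h (fun c => ?_) rfl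
      simp only [Function.comp, hg']
      split_ifs with hc
      · simp only [hg]
        rw [Ssum_bos e a b _ c ha ha' hb hb' (Int.toNat_of_nonneg hc),
          Int.toNat_of_nonneg hc]
      · rw [finsum_eq_zero_of_forall_eq_zero (phiI_neg _ _ _ _ (by omega))]; simp
    · intro l hl
      simp only [hg']
      split_ifs with hc
      · simp only [hg]
        rw [Ssum_eq good_tL, if_neg]
        · simp
        · intro hp
          unfold par at hp
          refine hl ⟨(l - a - b) / 2, ?_⟩
          simp only
          rw [min_eq_left (by omega), min_eq_left (by omega)] at hp
          omega
      · rfl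
  · intro l hl
    simp only [hg']
    rw [if_neg]
    intro hc
    exact hl ⟨l.toNat, Int.toNat_of_nonneg hc⟩
end

section
open Filter Topology

lemma phiI_hasSum {P a b : ℤ} (hP : 1 ≤ P) (ha : 0 ≤ a) (hb : 0 ≤ b) (c : ℤ) :
    HasSum (fun j => phiI P a b c j) (∑ᶠ j, phiI P a b c j) := by
  have hf : (Function.support (fun j => phiI P a b c j)).Finite := by
    refine (Set.finite_Icc (-(a + b + |c|)) (a + b + |c|)).subset fun j hj => ?_
    have h1 := le_abs_self c
    have h2 := neg_abs_le c
    have : (-(a + b + |c|)) ≤ P * j ∧ P * j ≤ a + b + |c| := by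
      by_contra hc
      refine hj ?_
      simp only [phiI]
      have h1 : ih (P * j + b + c) * ih (a + c - P * j) = 0 := by
        by_contra hc
        have := ih_mul_ne hc
        omega
      have h2 : ih (P * j + a + b + c) * ih (c - P * j) = 0 := by
        by_contra hc
        have := ih_mul_ne hc
        omega
      rw [h1, h2]; simp
    exact abs_le_mul hP this.1 this.2
  exact hasSum_of_HS ⟨hf, rfl⟩

lemma jbound {P b : ℤ} (hb : 1 ≤ b) (hP : b + 1 ≤ P) (j : ℤ) : |j| ≤ j * (P * j + b) := by
  rcases le_total 0 j with h | h
  · rw [abs_of_nonneg h]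
    nlinarith [mul_nonneg h h, mul_nonneg (mul_nonneg h h) (by omega : 0 ≤ P)]
  · rw [abs_of_nonpos h]
    rcases h.eq_or_lt with h | h
    · rw [h]; simp
    · have : P * j + b ≤ -1 := by nlinarith
      nlinarith

/-- the bosonic summand -/
def bosT (k : ℕ) (P b : ℤ) (N y : ℤ → ℤ) (p : ℤ × ((Fin k → ℕ) × ℤ)) : LaurentSeries ℚ :=
  tL ^ (4 * (p.1 * (P * p.1 + b))) * chT k (N p.1) p.2.1 (p.2.2 + y p.1)

lemma bosT_summable (k : ℕ) {P b : ℤ} (hb : 1 ≤ b) (hP : b + 1 ≤ P) (N y : ℤ → ℤ) (σ : ℤ)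
    (h : ∀ j, N j + 2 * y j = σ) : Summable (bosT k P b N y) := by
  refine summable_sm fun D => ?_
  refine ((finite_abs_le |D|).prod ((finite_sum_le k |D|).prod (finite_lin σ |D|))).subset ?_
  rintro ⟨j, n, c⟩ hh
  simp only [Set.mem_ofPred_eq] at hh
  have hj := h j
  have hl : N j + 2 * (c + y j) = σ + 2 * c := by linarith
  simp only [bosT, chT] at hh
  rw [hl] at hh
  have h0 : 0 ≤ N j + (c + y j) ∧ 0 ≤ c + y j := by
    apply ih_mul_ne
    intro h0
    refine hh ?_
    rw [h0]; simpa using sm_zero D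
  have hb' := tadT_bound k n (σ + 2 * c) (by omega)
  have hD : 4 * (j * (P * j + b)) + (tadT k n (σ + 2 * c) + (σ + 2 * c) ^ 2) < D := by
    by_contra hc
    refine hh (sm_mono (not_lt.1 hc) (sm_mul (sm_tL le_rfl) (sm_mul0 (sm_mul0 (sm_tL le_rfl) ?_) (sm_pih _))))
    exact sm_mul0 (sm_ih _) (sm_ih _)
  have h1 := abs_le_sq (σ + 2 * c)
  have h3 := abs_nonneg (σ + 2 * c)
  have h5 := le_abs_self D
  have h6 : 0 ≤ ∑ i, (n i : ℤ) := Finset.sum_nonneg fun _ _ => by positivity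
  have h7 := jbound hb hP j
  have h8 := abs_nonneg j
  refine ⟨?_, ?_, ?_⟩
  · show |j| ≤ |D|
    linarith
  · show ∑ i, (n i : ℤ) ≤ |D|
    linarith
  · show |σ + 2 * c| ≤ |D|
    linarith

lemma bosT_fiber (k : ℕ) (P b : ℤ) (N y : ℤ → ℤ) (j : ℤ) :
    HasSum (fun p => bosT k P b N y (j, p))
      (tL ^ (4 * (j * (P * j + b)) + (k + 1) * (N j) ^ 2) * eulerInf⁻¹) := by
  have h := (chain k (N j)).mul_left (tL ^ (4 * (j * (P * j + b))))
  rw [← (Equiv.prodCongr (Equiv.refl (Fin k → ℕ)) (Equiv.addRight (y j))).hasSum_iff] at h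
  refine HSc h (fun p => ?_) ?_
  · rfl
  · rw [zpow_add₀ tL_ne]; ring

theorem bos_main (k e a b : ℕ) (ha : 1 ≤ a) (ha' : a ≤ e + 1) (hb : 1 ≤ b) (hb' : b ≤ e + 2) :
    ∃ S : LaurentSeries ℚ,
      HasSum (fun j : ℤ => (tL ^ (4 * (j * ((e + 3) * j + b)) + (k + 1) * (2 * (e + 3) * j + b - a) ^ 2)
        - tL ^ (4 * (j * ((e + 3) * j + b)) + (k + 1) * (2 * (e + 3) * j + a + b) ^ 2)) * eulerInf⁻¹) S ∧
      HasSum (fun n : Fin k → ℕ => ∑' m, rT k e a b n m) (tL ^ ((b : ℤ) - a) * S) := by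
  have hs1 := bosT_summable k (P := e + 3) (b := b) (by omega) (by omega)
    (fun j => 2 * (e + 3) * j + b - a) (fun j => a - (e + 3) * j) (a + b) (fun j => by ring)
  have hs2 := bosT_summable k (P := e + 3) (b := b) (by omega) (by omega)
    (fun j => 2 * (e + 3) * j + a + b) (fun j => - ((e + 3) * j)) (a + b) (fun j => by ring)
  have hs := (hs1.sub hs2).hasSum
  refine ⟨_, hs.prod_fiberwise fun j => ?_, ?_⟩
  · refine HSc ((bosT_fiber k (e + 3) b _ _ j).sub (bosT_fiber k (e + 3) b _ _ j)) (fun p => rfl) ?_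
    rw [sub_mul]
  · have h2 := hs
    rw [← (Equiv.prodComm _ _).hasSum_iff] at h2
    have h3 := h2.prod_fiberwise (g := fun p : (Fin k → ℕ) × ℤ =>
      tL ^ (tadT k p.1 (a + b + 2 * p.2)) * pih p.1 *
      (tL ^ (((a : ℤ) + b + 2 * p.2) ^ 2) * ∑ᶠ j, phiI (e + 3) a b p.2 j)) ?_
    · refine HasSum.prod_fiberwise (h3.mul_left (tL ^ ((b : ℤ) - a))) fun n => ?_
      refine HSc (rT_bos k e a b n ha ha' hb hb') (fun c => ?_) rfl
      simp only
      rw [zpow_add₀ tL_ne (_ ^ 2)]; ring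
    · rintro ⟨n, c⟩
      have h4 := (phiI_hasSum (P := e + 3) (a := a) (b := b) (by omega) (by omega) (by omega) c).mul_left
        (tL ^ (tadT k n (a + b + 2 * c)) * pih n * tL ^ (((a : ℤ) + b + 2 * c) ^ 2))
      refine HSc h4 (fun j => ?_) (by simp only; ring)
      simp only [Function.comp, Equiv.prodComm_apply, Prod.swap_prod_mk, bosT, chT, phiI]
      rw [show 2 * ((e : ℤ) + 3) * j + b - a + 2 * (c + (a - (e + 3) * j)) = a + b + 2 * c by ring,
        show 2 * ((e : ℤ) + 3) * j + a + b + 2 * (c + (-((e + 3) * j))) = a + b + 2 * c by ring,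
        show 2 * ((e : ℤ) + 3) * j + b - a + (c + (a - (e + 3) * j)) = (e + 3) * j + b + c by ring,
        show 2 * ((e : ℤ) + 3) * j + a + b + (c + (-((e + 3) * j))) = (e + 3) * j + a + b + c by ring,
        show c + ((a : ℤ) - (e + 3) * j) = a + c - (e + 3) * j by ring,
        show c + -(((e : ℤ) + 3) * j) = c - (e + 3) * j by ring, zpow_add₀ tL_ne (tadT _ _ _)]
      ring

lemma reord (A B C D E : LaurentSeries ℚ) : A * B * C * D * E = A * B * D * (C * E) := by ring

lemma mAtN_one (d : ℕ) (m : Fin (d + 1) → ℕ) : mAtN (d + 1) m 1 = m 0 := by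
  unfold mAtN
  rw [Fin.sum_univ_succ]
  simp

lemma pih_eq {k : ℕ} (n : Fin k → ℕ) : pih n = (∏ i, qp tL (n i))⁻¹ := by
  unfold pih
  rw [← Finset.prod_inv_distrib]
  exact Finset.prod_congr rfl fun i _ => ih_nat _

theorem dual_bailey_chain_aux (k r a b : ℕ) (hr : 4 ≤ r) (ha : 1 ≤ a)
    (ha' : a ≤ r - 3) (hb : 1 ≤ b) (hb' : b ≤ r - 2) :
    virChar (r - 1) ((k + 1) * r - k) b ((k + 1) * a)
      = tL ^ (-(((a : ℤ) - b) * ((a : ℤ) - b - 1)) - (k : ℤ) * ((a : ℤ) - b) ^ 2)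
          * ∑' n : Fin k → ℕ, ∑' m : Fin (r - 3) → ℕ,
            (if parity r a b m then
              tL ^ (tadB k
                  (fun i => 2 * (n i : ℤ)
                    + (mAtN (r - 3) m 1 : ℤ) * (if (i : ℕ) + 1 = k then 1 else 0))
                  (fun i => 2 * (n i : ℤ)
                    + (mAtN (r - 3) m 1 : ℤ) * (if (i : ℕ) + 1 = k then 1 else 0)))
                * (∏ i : Fin k, qp tL (n i))⁻¹
                * tL ^ (quadC (r - 3) m - 2 * mAt (r - 3) m ((r : ℤ) - a - 1))
                * (qp tL (mAtN (r - 3) m 1))⁻¹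
                * ∏ i : Fin (r - 3),
                    (if 1 ≤ (i : ℕ) then gaussHalf tL (topC r a b 0 m i) (m i) else 1)
            else 0) := by
  obtain ⟨e, rfl⟩ : ∃ e, r = e + 4 := ⟨r - 4, by omega⟩
  obtain ⟨S, h1, h2⟩ := bos_main k e a b ha (by omega) hb (by omega)
  have e1 : ∀ (n : Fin k → ℕ) (m : Fin (e + 4 - 3) → ℕ), (if parity (e + 4) a b m then
              tL ^ (tadB k
                  (fun i => 2 * (n i : ℤ)
                    + (mAtN (e + 4 - 3) m 1 : ℤ) * (if (i : ℕ) + 1 = k then 1 else 0))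
                  (fun i => 2 * (n i : ℤ)
                    + (mAtN (e + 4 - 3) m 1 : ℤ) * (if (i : ℕ) + 1 = k then 1 else 0)))
                * (∏ i : Fin k, qp tL (n i))⁻¹
                * tL ^ (quadC (e + 4 - 3) m - 2 * mAt (e + 4 - 3) m (((e + 4 : ℕ) : ℤ) - a - 1))
                * (qp tL (mAtN (e + 4 - 3) m 1))⁻¹
                * ∏ i : Fin (e + 4 - 3),
                    (if 1 ≤ (i : ℕ) then gaussHalf tL (topC (e + 4) a b 0 m i) (m i) else 1)
            else 0) = rT k e a b n m := by
    intro n m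
    rw [show mAtN (e + 4 - 3) m 1 = m (0 : Fin (e + 1)) from mAtN_one e m]
    unfold rT sT
    rw [pih_eq, ih_nat]
    by_cases hp : parity (e + 4) a b m
    · rw [if_pos hp]
      refine Eq.trans ?_ (congrArg _ (if_pos hp).symm)
      exact reord _ _ _ _ _
    · rw [if_neg hp]
      refine Eq.trans ?_ (congrArg _ (if_neg hp).symm)
      rw [mul_zero]
  have e2 : ∑' n : Fin k → ℕ, ∑' m : Fin (e + 4 - 3) → ℕ, rT k e a b n m = tL ^ ((b : ℤ) - a) * S := h2.tsum_eq
  simp only [e1]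
  rw [e2]
  unfold virChar
  have h3 := h1.mul_left (tL ^ (-((k + 1) * ((b : ℤ) - a) ^ 2)) * eulerInf)
  have e3 : HasSum (fun j : ℤ =>
    (tL ^ (4 * (j * (((e + 4 - 1 : ℕ) : ℤ) * (((k + 1) * (e + 4) - k : ℕ) : ℤ) * j
        + (((k + 1) * (e + 4) - k : ℕ) : ℤ) * b - ((e + 4 - 1 : ℕ) : ℤ) * (((k + 1) * a : ℕ) : ℤ))))
      - tL ^ (4 * ((j * ((e + 4 - 1 : ℕ) : ℤ) + b) * (j * (((k + 1) * (e + 4) - k : ℕ) : ℤ) + (((k + 1) * a : ℕ) : ℤ))))))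
      (tL ^ (-((k + 1) * ((b : ℤ) - a) ^ 2)) * eulerInf * S) := by
    refine HSc h3 (fun j => ?_) rfl
    have c1 : ((e + 4 - 1 : ℕ) : ℤ) = e + 3 := by
      rw [show e + 4 - 1 = e + 3 by omega]; push_cast; ring
    have c2 : (((k + 1) * (e + 4) - k : ℕ) : ℤ) = (k + 1) * (e + 4) - k := by
      rw [Nat.cast_sub (by nlinarith)]; push_cast; ring
    rw [c1, c2]
    push_cast
    have c3 : ∀ x : LaurentSeries ℚ, tL ^ (-((k + 1) * ((b : ℤ) - a) ^ 2)) * eulerInf * (x * eulerInf⁻¹)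
        = tL ^ (-((k + 1) * ((b : ℤ) - a) ^ 2)) * x := by
      intro x
      have := euler_ne
      field_simp
    rw [c3, mul_sub (tL ^ _), ← zpow_add₀ tL_ne, ← zpow_add₀ tL_ne]
    congr 2 <;> ring
  rw [e3.tsum_eq, ← mul_assoc (tL ^ _) (tL ^ _) S, ← zpow_add₀ tL_ne]
  rw [show -(((a : ℤ) - b) * ((a : ℤ) - b - 1)) - (k : ℤ) * ((a : ℤ) - b) ^ 2 + (b - a)
    = -((k + 1) * ((b : ℤ) - a) ^ 2) by ring]
  have := euler_ne
  field_simp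
end

/-- **Rogers–Ramanujan identity for `χ^{(r-1,(k+1)r-k)}_{b,(k+1)a}(q)`** (dual Bailey
pair applied to Melzer's identities), stated in the variable `t = q^{1/4}`
(all exponents multiplied by `4`); for `k = 0` the sum over `n` is absent. -/
theorem dual_bailey_chain (k r a b : ℕ) (hr : 4 ≤ r) (ha : 1 ≤ a)
    (ha' : a ≤ r - 3) (hb : 1 ≤ b) (hb' : b ≤ r - 2) :
    virChar (r - 1) ((k + 1) * r - k) b ((k + 1) * a)
      = tL ^ (-(((a : ℤ) - b) * ((a : ℤ) - b - 1)) - (k : ℤ) * ((a : ℤ) - b) ^ 2)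
          * ∑' n : Fin k → ℕ, ∑' m : Fin (r - 3) → ℕ,
            (if parity r a b m then
              tL ^ (tadB k
                  (fun i => 2 * (n i : ℤ)
                    + (mAtN (r - 3) m 1 : ℤ) * (if (i : ℕ) + 1 = k then 1 else 0))
                  (fun i => 2 * (n i : ℤ)
                    + (mAtN (r - 3) m 1 : ℤ) * (if (i : ℕ) + 1 = k then 1 else 0)))
                * (∏ i : Fin k, qp tL (n i))⁻¹
                * tL ^ (quadC (r - 3) m - 2 * mAt (r - 3) m ((r : ℤ) - a - 1))
                * (qp tL (mAtN (r - 3) m 1))⁻¹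
                * ∏ i : Fin (r - 3),
                    (if 1 ≤ (i : ℕ) then gaussHalf tL (topC r a b 0 m i) (m i) else 1)
            else 0) := by
  exact dual_bailey_chain_aux k r a b hr ha ha' hb hb'
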